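/- arXiv:math/9810012 — 2 statements merged into one kernel-verified Lean document; each statement's English description precedes it below -/
import Mathlib

section
/- For every n ≥ 1, the space rat(n,1) has exactly n+1 path components. -/
open OnePoint Projectivization

noncomputable section

/-- Real projective `m`-space, the projectivization of `ℝ^{m+1}`. -/
abbrev RP (m : ℕ) := Projectivization ℝ (Fin (m + 1) → ℝ)

instance (m : ℕ) : TopologicalSpace (RP m) :=
  inferInstanceAs (TopologicalSpace (Quotient _))

/-- The basepoint `[1 : 1 : ⋯ : 1]` of `ℝP^m`. -/
def basept (m : ℕ) : RP m :=
  Projectivization.mk ℝ (fun _ => (1 : ℝ)) (by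
    intro h
    exact one_ne_zero (congrFun h 0))

/-- The based loop space `Ω ℝP^m`: continuous maps `ℝP¹ = ℝ ∪ {∞} → ℝP^m`
sending `∞` to the basepoint, with the compact-open topology. -/
abbrev OmegaRP (m : ℕ) := {f : C(OnePoint ℝ, RP m) // f ∞ = basept m}

/-- The set of based loops arising from `(m+1)`-tuples of monic real polynomials of
degree `n` with no common complex root. -/
def RRat (n m : ℕ) : Set (OmegaRP m) :=
  {f | ∃ p : Fin (m + 1) → Polynomial ℝ,
    (∀ i, (p i).Monic) ∧ (∀ i, (p i).natDegree = n) ∧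
    (∀ z : ℂ, ∃ i, Polynomial.aeval z (p i) ≠ 0) ∧
    ∀ x : ℝ, ∃ hx : (fun i => (p i).eval x) ≠ 0,
      f.1 (x : OnePoint ℝ) = Projectivization.mk ℝ (fun i => (p i).eval x) hx}

/-- `rat n m` is the closure of `RRat n m` in `Ω ℝP^m`. -/
def ratSet (n m : ℕ) : Set (OmegaRP m) := closure (RRat n m)

namespace RatLoop

open Filter Topology Complex ComplexConjugate

/-- The Cayley transform `x ↦ (x - i) / (x + i)` on the projective line, with `∞ ↦ 1`. -/
def cayley (y : OnePoint ℝ) : ℂ := y.elim 1 fun x => ((x : ℂ) - I) / (x + I)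

lemma ofReal_sub_ne_zero {z : ℂ} (hz : z.im ≠ 0) (x : ℝ) : (x : ℂ) - z ≠ 0 := by
  intro h
  exact hz (by simpa using congrArg im h)

lemma ofReal_add_I_ne_zero (x : ℝ) : (x : ℂ) + I ≠ 0 := by
  simpa using ofReal_sub_ne_zero (z := -I) (by simp) x

lemma tendsto_ofReal_cobounded : Tendsto ((↑) : ℝ → ℂ) (cocompact ℝ) (Bornology.cobounded ℂ) := by
  rw [← tendsto_norm_atTop_iff_cobounded]
  simpa only [norm_real] using tendsto_norm_cocompact_atTop (E := ℝ)

lemma continuous_cayley : Continuous cayley := by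
  rw [continuous_iff_continuousAt]
  intro y
  induction y with
  | infty =>
    rw [OnePoint.continuousAt_infty', coclosedCompact_eq_cocompact]
    have h : Tendsto (fun x : ℝ => 1 - 2 * I * ((x : ℂ) + I)⁻¹) (cocompact ℝ) (𝓝 1) := by
      have h1 : Tendsto (fun x : ℝ => (x : ℂ) + I) (cocompact ℝ) (Bornology.cobounded ℂ) := by
        exact (tendsto_add_const_cobounded I).comp tendsto_ofReal_cobounded
      simpa using ((tendsto_inv₀_cobounded.comp h1).const_mul (2 * I)).const_sub 1
    refine h.congr fun x => ?_
    have := ofReal_add_I_ne_zero x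
    simp only [Function.comp, cayley, OnePoint.elim_some]
    field_simp
    ring
  | coe x =>
    rw [OnePoint.continuousAt_coe]
    have : Continuous fun x : ℝ => ((x : ℂ) - I) / (x + I) := by
      fun_prop (disch := exact ofReal_add_I_ne_zero)
    exact this.continuousAt

/-- The unit-modulus function `x ↦ (x - z) / (x - conj z)`, extended by `1` at `∞`. -/
def factor (z : ℂ) (y : OnePoint ℝ) : ℂ :=
  (I * (1 + cayley y) - z * (1 - cayley y)) / (I * (1 + cayley y) - conj z * (1 - cayley y))

@[simp] lemma factor_infty (z : ℂ) : factor z ∞ = 1 := by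
  simp [factor, cayley]

lemma cayley_numerator (z : ℂ) (x : ℝ) :
    I * (1 + cayley x) - z * (1 - cayley x) = 2 * I / (x + I) * (x - z) := by
  have := ofReal_add_I_ne_zero x
  simp only [cayley, OnePoint.elim_some]
  field_simp
  ring

lemma cayley_numerator_ne_zero {z : ℂ} (hz : z.im ≠ 0) (y : OnePoint ℝ) :
    I * (1 + cayley y) - z * (1 - cayley y) ≠ 0 := by
  induction y with
  | infty => simp [cayley]
  | coe x =>
    rw [cayley_numerator]
    exact mul_ne_zero (div_ne_zero (by simp) (ofReal_add_I_ne_zero x)) (ofReal_sub_ne_zero hz x)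

lemma conj_im_ne_zero {z : ℂ} (hz : z.im ≠ 0) : (conj z).im ≠ 0 := by simpa using hz

lemma factor_coe (z : ℂ) (x : ℝ) : factor z x = (x - z) / (x - conj z) := by
  rw [factor, cayley_numerator, cayley_numerator, mul_div_mul_left]
  exact div_ne_zero (by simp) (ofReal_add_I_ne_zero x)

lemma norm_factor {z : ℂ} (hz : z.im ≠ 0) (y : OnePoint ℝ) : ‖factor z y‖ = 1 := by
  induction y with
  | infty => simp
  | coe x =>
    have h : (x : ℂ) - conj z = conj ((x : ℂ) - z) := by simp
    rw [factor_coe, norm_div, h, RCLike.norm_conj, div_self]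
    exact norm_ne_zero_iff.2 (ofReal_sub_ne_zero hz x)

lemma factor_ne_zero {z : ℂ} (hz : z.im ≠ 0) (y : OnePoint ℝ) : factor z y ≠ 0 :=
  norm_ne_zero_iff.1 (by simp [norm_factor hz])

lemma factor_neg_I (y : OnePoint ℝ) : factor (-I) y = (factor I y)⁻¹ := by
  simp [factor]

lemma continuousAt_factor {z : ℂ} (hz : z.im ≠ 0) (y : OnePoint ℝ) :
    ContinuousAt (fun q : ℂ × OnePoint ℝ => factor q.1 q.2) (z, y) := by
  have h : ContinuousAt (fun q : ℂ × OnePoint ℝ => cayley q.2) (z, y) :=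
    (continuous_cayley.comp continuous_snd).continuousAt
  have hc : Continuous (conj : ℂ → ℂ) := continuous_conj
  unfold factor
  refine ContinuousAt.div (by fun_prop) ?_ (cayley_numerator_ne_zero (conj_im_ne_zero hz) y)
  have : ContinuousAt (fun q : ℂ × OnePoint ℝ => conj q.1) (z, y) :=
    (hc.comp continuous_fst).continuousAt
  fun_prop

/-! ### The identification of `ℝP¹` with the unit circle -/

lemma ofReal_add_mul_I_ne_zero {v : Fin 2 → ℝ} (hv : v ≠ 0) : (v 0 : ℂ) + v 1 * I ≠ 0 := by
  intro h
  apply hv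
  have h0 : v 0 = 0 := by simpa using congrArg re h
  have h1 : v 1 = 0 := by simpa using congrArg im h
  ext i
  fin_cases i <;> assumption

/-- The map `[u : v] ↦ (u + iv) / (u - iv)` from `ℝP¹` to `ℂ`. -/
def toCircle : RP 1 → ℂ :=
  Projectivization.lift
    (fun v : {v : Fin 2 → ℝ // v ≠ 0} => ((v.1 0 : ℂ) + v.1 1 * I) / conj ((v.1 0 : ℂ) + v.1 1 * I))
    (by
      intro a b t h
      have ht : (t : ℂ) ≠ 0 := by
        rintro ht
        apply a.2
        rw [h, ofReal_eq_zero.1 ht, zero_smul]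
      have hb := ofReal_add_mul_I_ne_zero b.2
      have hb' := (map_ne_zero (starRingEnd ℂ)).2 hb
      have : (a.1 0 : ℂ) + a.1 1 * I = t * ((b.1 0 : ℂ) + b.1 1 * I) := by
        rw [h]; simp; ring
      rw [this, map_mul, conj_ofReal, mul_div_mul_left _ _ ht])

lemma toCircle_mk (v : Fin 2 → ℝ) (hv : v ≠ 0) :
    toCircle (Projectivization.mk ℝ v hv)
      = ((v 0 : ℂ) + v 1 * I) / conj ((v 0 : ℂ) + v 1 * I) := rfl

lemma toCircle_basept : toCircle (basept 1) = I := by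
  rw [basept, toCircle_mk]
  have h : (1 : ℂ) - I ≠ 0 := by
    intro h; simpa using congrArg re h
  simp only [ofReal_one, one_mul, map_add, map_one, conj_I, ← sub_eq_add_neg]
  rw [div_eq_iff h]
  ring_nf
  simp
  ring

lemma continuous_toCircle : Continuous toCircle := by
  refine Continuous.quotient_lift ?_ _
  have hc : Continuous (conj : ℂ → ℂ) := continuous_conj
  have h : Continuous fun v : {v : Fin 2 → ℝ // v ≠ 0} => ((v.1 0 : ℂ) + v.1 1 * I) := by
    have h (i : Fin 2) : Continuous fun v : {v : Fin 2 → ℝ // v ≠ 0} => (v.1 i : ℂ) :=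
      continuous_ofReal.comp ((continuous_apply i).comp continuous_subtype_val)
    exact (h 0).add ((h 1).mul continuous_const)
  exact h.div (hc.comp h) fun v => (map_ne_zero _).2 (ofReal_add_mul_I_ne_zero v.2)

lemma norm_toCircle (p : RP 1) : ‖toCircle p‖ = 1 := by
  induction p using Projectivization.ind with
  | h v hv =>
    rw [toCircle_mk, norm_div, RCLike.norm_conj, div_self]
    exact norm_ne_zero_iff.2 (ofReal_add_mul_I_ne_zero hv)

lemma injective_toCircle : Function.Injective toCircle := by
  intro p q h
  induction p using Projectivization.ind with
  | h v hv =>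
  induction q using Projectivization.ind with
  | h w hw =>
    have ev := (map_ne_zero (starRingEnd ℂ)).2 (ofReal_add_mul_I_ne_zero hv)
    have ew := (map_ne_zero (starRingEnd ℂ)).2 (ofReal_add_mul_I_ne_zero hw)
    rw [toCircle_mk, toCircle_mk, div_eq_div_iff ev ew] at h
    have h1 : v 1 * w 0 = v 0 * w 1 := by
      have := congrArg im h
      simp at this
      linarith
    rw [Projectivization.mk_eq_mk_iff']
    by_cases h0 : w 0 = 0
    · have hw1 : w 1 ≠ 0 := by
        intro hw1; apply hw; ext i; fin_cases i <;> assumption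
      refine ⟨v 1 / w 1, ?_⟩
      have hv0 : v 0 = 0 := by
        rw [h0, mul_zero] at h1
        exact (mul_eq_zero.1 h1.symm).resolve_right hw1
      ext i
      fin_cases i <;> simp [h0, hv0, hw1]
    · refine ⟨v 0 / w 0, ?_⟩
      ext i
      fin_cases i
      · simp [h0]
      · simp; field_simp; linarith

/-- The point of `ℝP¹` with homogeneous coordinates `[cos t : sin t]`. -/
def angle (t : ℝ) : RP 1 :=
  Projectivization.mk ℝ ![Real.cos t, Real.sin t] (by
    intro h
    have h0 : Real.cos t = 0 := congrFun h 0
    have h1 : Real.sin t = 0 := congrFun h 1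
    have := Real.sin_sq_add_cos_sq t
    simp [h0, h1] at this)

lemma continuous_angle : Continuous angle := by
  refine continuous_quotient_mk'.comp (Continuous.subtype_mk ?_ _)
  refine continuous_pi fun i => ?_
  fin_cases i
  · exact Real.continuous_cos
  · exact Real.continuous_sin

lemma toCircle_angle (t : ℝ) : toCircle (angle t) = exp (2 * t * I) := by
  rw [angle, toCircle_mk]
  simp only [Matrix.cons_val_zero, Matrix.cons_val_one, ofReal_cos, ofReal_sin, ← exp_mul_I,
    ← exp_conj, ← exp_sub]
  congr 1
  simp
  ring

lemma toCircle_surjOn {w : ℂ} (hw : ‖w‖ = 1) :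
    ∃ t ∈ Set.Icc (-Real.pi) Real.pi, toCircle (angle t) = w := by
  refine ⟨w.arg / 2, ⟨?_, ?_⟩, ?_⟩
  · linarith [neg_pi_lt_arg w, Real.pi_pos]
  · linarith [arg_le_pi w, Real.pi_pos]
  · rw [toCircle_angle]
    have := norm_mul_exp_arg_mul_I w
    rw [hw, ofReal_one, one_mul] at this
    refine Eq.trans ?_ this
    push_cast
    congr 1
    ring

instance : CompactSpace (RP 1) := by
  have : Set.univ = angle '' Set.Icc (-Real.pi) Real.pi := by
    refine (Set.eq_univ_of_forall fun p => ?_).symm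
    obtain ⟨t, ht, h⟩ := toCircle_surjOn (norm_toCircle p)
    exact ⟨t, ht, injective_toCircle h⟩
  exact ⟨this ▸ isCompact_Icc.image continuous_angle⟩

lemma isClosedEmbedding_toCircle : IsClosedEmbedding toCircle :=
  continuous_toCircle.isClosedEmbedding injective_toCircle

attribute [irreducible] factor toCircle

/-! ### Degree of a unit-modulus function on the line -/

/-- `HasDeg u d`: the function `u` has a continuous argument on `ℝ`, with limits at `±∞` that
differ by `2πd`. -/
def HasDeg (u : ℝ → ℂ) (d : ℤ) : Prop :=
  ∃ θ : ℝ → ℝ, Continuous θ ∧ (∀ x, u x = exp (θ x * I)) ∧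
    ∃ a, Tendsto θ atBot (𝓝 a) ∧ Tendsto θ atTop (𝓝 (a + 2 * Real.pi * d))

lemma HasDeg.mul {u v : ℝ → ℂ} {d e : ℤ} (hu : HasDeg u d) (hv : HasDeg v e) :
    HasDeg (fun x => u x * v x) (d + e) := by
  obtain ⟨θ, hθ, h1, a, h2, h3⟩ := hu
  obtain ⟨η, hη, k1, b, k2, k3⟩ := hv
  refine ⟨fun x => θ x + η x, hθ.add hη, fun x => ?_, a + b, h2.add k2, ?_⟩
  · simp only [h1, k1, ← exp_add]
    congr 1
    push_cast
    ring
  · convert h3.add k3 using 2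
    push_cast
    ring

lemma hasDeg_const {w : ℂ} (hw : ‖w‖ = 1) : HasDeg (fun _ => w) 0 := by
  refine ⟨fun _ => w.arg, continuous_const, fun _ => ?_, w.arg, tendsto_const_nhds, ?_⟩
  · simpa [hw] using (norm_mul_exp_arg_mul_I w).symm
  · simp

lemma HasDeg.prod {ι : Type*} (s : Finset ι) {u : ι → ℝ → ℂ} {d : ι → ℤ}
    (h : ∀ i ∈ s, HasDeg (u i) (d i)) : HasDeg (fun x => ∏ i ∈ s, u i x) (∑ i ∈ s, d i) := by
  classical
  induction s using Finset.induction_on with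
  | empty => simpa using hasDeg_const (w := 1) (by simp)
  | insert i s hi ih =>
    simp only [Finset.prod_insert hi, Finset.sum_insert hi]
    exact (h i (by simp)).mul (ih fun j hj => h j (by simp [hj]))

lemma HasDeg.unique {u : ℝ → ℂ} {d e : ℤ} (hd : HasDeg u d) (he : HasDeg u e) : d = e := by
  obtain ⟨θ, hθ, h1, a, h2, h3⟩ := hd
  obtain ⟨η, hη, k1, b, k2, k3⟩ := he
  have key : ∀ x, ∃ m : ℤ, θ x - η x = m * (2 * Real.pi) := by
    intro x
    obtain ⟨m, hm⟩ := exp_eq_exp_iff_exists_int.1 ((h1 x).symm.trans (k1 x))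
    refine ⟨m, ?_⟩
    have := congrArg im hm
    simp at this
    linarith
  choose m hm using key
  have hc : Continuous m := by
    have : Continuous fun x => (m x : ℝ) := by
      have h : (fun x => (m x : ℝ)) = fun x => (θ x - η x) / (2 * Real.pi) := by
        ext x
        rw [hm, mul_div_assoc, div_self (by positivity), mul_one]
      rw [h]
      fun_prop
    exact Int.isClosedEmbedding_coe_real.continuous_iff.2 this
  have hconst : ∀ x, θ x - η x = m 0 * (2 * Real.pi) := fun x => by
    rw [hm, PreconnectedSpace.constant inferInstance hc (x := x) (y := 0)]
  have l1 := tendsto_nhds_unique (h2.sub k2) (tendsto_const_nhds.congr fun x => (hconst x).symm)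
  have l2 := tendsto_nhds_unique (h3.sub k3) (tendsto_const_nhds.congr fun x => (hconst x).symm)
  have : 2 * Real.pi * ((d : ℝ) - e) = 0 := by linear_combination l2 - l1
  have hde : (d : ℝ) - e = 0 := (mul_eq_zero.1 this).resolve_left (by positivity)
  exact_mod_cast sub_eq_zero.1 hde

lemma mem_slitPlane_of_norm_sub_one_lt {w : ℂ} (h : ‖w - 1‖ < 1) : w ∈ slitPlane := by
  simpa using mem_slitPlane_of_norm_lt_one h

lemma HasDeg.of_norm_sub_lt {u v : ℝ → ℂ} {d : ℤ} {l : ℂ} (hu : HasDeg u d) (hl : ‖l‖ = 1)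
    (hv : Continuous v) (hv1 : ∀ x, ‖v x‖ = 1) (huv : ∀ x, ‖v x - u x‖ < 1)
    (hul : Tendsto u (cocompact ℝ) (𝓝 l)) (hvl : Tendsto v (cocompact ℝ) (𝓝 l)) :
    HasDeg v d := by
  have hun : ∀ x, ‖u x‖ = 1 := by
    obtain ⟨θ, -, h, -⟩ := hu
    intro x
    rw [h, norm_exp_ofReal_mul_I]
  have huc : Continuous u := by
    obtain ⟨θ, hθ, h, -⟩ := hu
    rw [funext h]
    fun_prop
  have hu0 : ∀ x, u x ≠ 0 := fun x => norm_ne_zero_iff.1 (by simp [hun])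
  have hl0 : l ≠ 0 := norm_ne_zero_iff.1 (by simp [hl])
  have hq1 : ∀ x, ‖v x / u x‖ = 1 := fun x => by simp [hv1, hun]
  have hslit : ∀ x, v x / u x ∈ slitPlane := by
    intro x
    apply mem_slitPlane_of_norm_sub_one_lt
    have : v x / u x - 1 = (v x - u x) / u x := by field_simp [hu0 x]
    rw [this, norm_div, hun, div_one]
    exact huv x
  have hq : HasDeg (fun x => v x / u x) 0 := by
    have hlim : Tendsto (fun x => (v x / u x).arg) (cocompact ℝ) (𝓝 0) := by
      have : Tendsto (fun x => v x / u x) (cocompact ℝ) (𝓝 1) := by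
        exact div_self hl0 ▸ hvl.div hul hl0
      exact arg_one ▸ (continuousAt_arg (x := 1) (by simp)).tendsto.comp this
    rw [cocompact_eq_atBot_atTop, tendsto_sup] at hlim
    refine ⟨fun x => (v x / u x).arg, ?_, fun x => ?_, 0, hlim.1, by simpa using hlim.2⟩
    · exact continuous_iff_continuousAt.2 fun x =>
        (continuousAt_arg (hslit x)).comp (f := fun x => v x / u x)
          (hv.div huc hu0).continuousAt
    · have := norm_mul_exp_arg_mul_I (v x / u x)
      rw [hq1, ofReal_one, one_mul] at this
      exact this.symm
  have := hu.mul hq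
  rw [add_zero] at this
  convert this using 2 with x
  rw [mul_div_cancel₀ _ (hu0 x)]

/-- The sign of the imaginary part of a non-real number. -/
def sgn (z : ℂ) : ℤ := if 0 < z.im then 1 else -1

lemma sgn_of_pos {z : ℂ} (h : 0 < z.im) : sgn z = 1 := if_pos h

lemma sgn_of_neg {z : ℂ} (h : z.im < 0) : sgn z = -1 := if_neg h.not_gt

lemma exp_two_arctan (t : ℝ) :
    exp ((2 * Real.arctan t : ℝ) * I) = (1 + t * I) / (1 - t * I) := by
  have h1 : exp (Real.arctan t * I) = (1 + t * I) / (√(1 + t ^ 2) : ℝ) := by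
    rw [exp_mul_I, ← ofReal_cos, ← ofReal_sin, Real.cos_arctan, Real.sin_arctan]
    push_cast
    ring
  have h2 : ((√(1 + t ^ 2) : ℝ) : ℂ) ^ 2 = (1 + t * I) * (1 - t * I) := by
    rw [← ofReal_pow, Real.sq_sqrt (by positivity)]
    push_cast
    linear_combination (t : ℂ) ^ 2 * I_sq
  have hne : (1 : ℂ) + t * I ≠ 0 := by intro h; simpa using congrArg re h
  have hne' : (1 : ℂ) - t * I ≠ 0 := by intro h; simpa using congrArg re h
  have h3 : exp ((2 * Real.arctan t : ℝ) * I) = exp (Real.arctan t * I) ^ 2 := by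
    rw [← exp_nat_mul]
    congr 1
    push_cast
    ring
  rw [h3, h1, div_pow, h2]
  field_simp

lemma hasDeg_factor {z : ℂ} (hz : z.im ≠ 0) : HasDeg (fun x => factor z x) (sgn z) := by
  have hz' : (z.im : ℂ) ≠ 0 := ofReal_ne_zero.2 hz
  have hval : ∀ x : ℝ, factor z x
      = -1 * exp ((2 * Real.arctan ((x - z.re) / z.im) : ℝ) * I) := by
    intro x
    have e1 : (x : ℂ) - z = z.im * -I * (1 + ((x - z.re) / z.im : ℝ) * I) := by
      push_cast
      field_simp
      ring_nf
      simp
      linear_combination re_add_im z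
    have e2 : (x : ℂ) - conj z = z.im * I * (1 - ((x - z.re) / z.im : ℝ) * I) := by
      refine (by simp : (x : ℂ) - conj z = conj ((x : ℂ) - z)).trans ?_
      rw [e1]
      simp [sub_eq_add_neg]
    rw [factor_coe, exp_two_arctan, e1, e2]
    have hI := I_ne_zero
    have : (z.im : ℂ) * I ≠ 0 := mul_ne_zero hz' hI
    rw [mul_div_mul_comm]
    congr 1
    field_simp
  have harg : HasDeg (fun x : ℝ => exp ((2 * Real.arctan ((x - z.re) / z.im) : ℝ) * I)) (sgn z) := by
    refine ⟨_, by fun_prop, fun x => rfl, ?_⟩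
    have top := tendsto_nhds_of_tendsto_nhdsWithin Real.tendsto_arctan_atTop
    have bot := tendsto_nhds_of_tendsto_nhdsWithin Real.tendsto_arctan_atBot
    have t1 : Tendsto (fun x : ℝ => x - z.re) atTop atTop :=
      tendsto_atTop_add_const_right _ _ tendsto_id
    have t2 : Tendsto (fun x : ℝ => x - z.re) atBot atBot :=
      tendsto_atBot_add_const_right _ _ tendsto_id
    rcases lt_or_gt_of_ne hz with h | h
    · refine ⟨2 * (Real.pi / 2), (top.comp ((tendsto_div_const_atTop_of_neg h).2 t2)).const_mul 2, ?_⟩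
      convert (bot.comp (t1.atTop_div_const_of_neg h)).const_mul 2 using 2
      · simp
      · rw [sgn_of_neg h]
        push_cast
        ring
    · refine ⟨2 * -(Real.pi / 2), (bot.comp (t2.atBot_div_const h)).const_mul 2, ?_⟩
      convert (top.comp (t1.atTop_div_const h)).const_mul 2 using 2
      · simp
      · rw [sgn_of_pos h]
        push_cast
        ring
  simpa only [hval, zero_add] using (hasDeg_const (w := -1) (by simp)).mul harg

/-! ### Loops with prescribed roots -/

/-- `n`-tuples of non-real complex numbers. -/
abbrev NonrealTuple (n : ℕ) := {z : Fin n → ℂ // ∀ j, (z j).im ≠ 0}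

variable {n : ℕ}

lemma continuous_prod_factor :
    Continuous fun q : NonrealTuple n × OnePoint ℝ => I * ∏ j, factor (q.1.1 j) q.2 := by
  refine continuous_const.mul (continuous_finsetProd _ fun j _ => ?_)
  refine continuous_iff_continuousAt.2 fun q => ?_
  have h : Continuous fun q : NonrealTuple n × OnePoint ℝ => (q.1.1 j, q.2) :=
    (((continuous_apply j).comp continuous_subtype_val).comp continuous_fst).prodMk continuous_snd
  exact ContinuousAt.comp (f := fun q : NonrealTuple n × OnePoint ℝ => (q.1.1 j, q.2))
    (g := fun q : ℂ × OnePoint ℝ => factor q.1 q.2) (continuousAt_factor (q.1.2 j) q.2)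
    h.continuousAt

lemma toCircle_invFun_prod (z : NonrealTuple n) (y : OnePoint ℝ) :
    toCircle (Function.invFun toCircle (I * ∏ j, factor (z.1 j) y))
      = I * ∏ j, factor (z.1 j) y := by
  apply Function.invFun_eq
  obtain ⟨t, -, h⟩ := toCircle_surjOn (w := I * ∏ j, factor (z.1 j) y)
    (by simp [norm_factor (z.2 _)])
  exact ⟨_, h⟩

lemma continuous_invFun_prod :
    Continuous fun q : NonrealTuple n × OnePoint ℝ =>
      Function.invFun toCircle (I * ∏ j, factor (q.1.1 j) q.2) := by
  rw [isClosedEmbedding_toCircle.continuous_iff]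
  refine continuous_prod_factor.congr fun q => ?_
  exact (toCircle_invFun_prod q.1 q.2).symm

/-- The loop `x ↦ [Re P(x) : Im P(x)]` for the polynomial `P = (1 + i) ∏ (X - z j)`. -/
def loop (z : NonrealTuple n) : OmegaRP 1 :=
  ⟨⟨fun y => Function.invFun toCircle (I * ∏ j, factor (z.1 j) y),
    continuous_invFun_prod.comp (Continuous.prodMk_right z)⟩,
    injective_toCircle ((toCircle_invFun_prod z ∞).trans (by simp [toCircle_basept]))⟩

lemma toCircle_loop (z : NonrealTuple n) (y : OnePoint ℝ) :
    toCircle ((loop z).1 y) = I * ∏ j, factor (z.1 j) y := toCircle_invFun_prod z y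

lemma continuous_loop : Continuous (loop : NonrealTuple n → OmegaRP 1) :=
  Continuous.subtype_mk
    (ContinuousMap.continuous_of_continuous_uncurry _ continuous_invFun_prod) _

lemma eq_loop {f : OmegaRP 1} {z : NonrealTuple n}
    (h : ∀ x : ℝ, toCircle (f.1 x) = I * ∏ j, factor (z.1 j) x) : f = loop z := by
  ext y
  induction y with
  | infty => rw [f.2, (loop z).2]
  | coe x => exact injective_toCircle ((h x).trans (toCircle_loop z x).symm)

/-- The difference between the numbers of entries in the upper and lower half-planes. -/
def deg (z : NonrealTuple n) : ℤ := ∑ j, sgn (z.1 j)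

lemma hasDeg_prod_factor {ι : Type*} (s : Finset ι) {w : ι → ℂ} (hw : ∀ j ∈ s, (w j).im ≠ 0) :
    HasDeg (fun x => I * ∏ j ∈ s, factor (w j) x) (∑ j ∈ s, sgn (w j)) := by
  have := (hasDeg_const (w := I) (by simp)).mul
    (HasDeg.prod s fun j hj => hasDeg_factor (hw j hj))
  rwa [zero_add] at this

lemma hasDeg_loop (z : NonrealTuple n) : HasDeg (fun x => toCircle ((loop z).1 x)) (deg z) := by
  simpa only [toCircle_loop, deg] using hasDeg_prod_factor Finset.univ fun j _ => z.2 j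

lemma continuous_toCircle_apply (f : OmegaRP 1) : Continuous fun y => toCircle (f.1 y) :=
  continuous_toCircle.comp f.1.continuous

lemma tendsto_toCircle_apply (f : OmegaRP 1) :
    Tendsto (fun x : ℝ => toCircle (f.1 x)) (cocompact ℝ) (𝓝 I) := by
  have h := (continuous_toCircle_apply f).tendsto ∞
  rw [f.2, toCircle_basept] at h
  rw [← coclosedCompact_eq_cocompact]
  exact h.comp tendsto_coe_infty

lemma eventually_norm_sub_lt (f : OmegaRP 1) :
    ∀ᶠ g in 𝓝 f, ∀ y, ‖toCircle (g.1 y) - toCircle (f.1 y)‖ < 1 := by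
  let T : C(RP 1, ℂ) := ⟨toCircle, continuous_toCircle⟩
  have hT : Continuous fun g : OmegaRP 1 => T.comp g.1 :=
    (ContinuousMap.continuous_postcomp T).comp continuous_subtype_val
  filter_upwards [hT.continuousAt.eventually (Metric.ball_mem_nhds (T.comp f.1) one_pos)] with g hg
  intro y
  rw [← dist_eq_norm]
  exact (ContinuousMap.dist_lt_iff one_pos).1 (Metric.mem_ball.1 hg) y

lemma eventually_hasDeg {f : OmegaRP 1} {d : ℤ} (hf : HasDeg (fun x => toCircle (f.1 x)) d) :
    ∀ᶠ g in 𝓝 f, HasDeg (fun x => toCircle (g.1 x)) d := by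
  filter_upwards [eventually_norm_sub_lt f] with g hg
  exact hf.of_norm_sub_lt (l := I) (by simp)
    ((continuous_toCircle_apply g).comp OnePoint.continuous_coe)
    (fun x => norm_toCircle _) (fun x => hg x) (tendsto_toCircle_apply f) (tendsto_toCircle_apply g)

/-! ### Comparison with rational loops -/

open Polynomial in
lemma exists_re_im (P : ℂ[X]) :
    ∃ p q : ℝ[X], P = p.map (algebraMap ℝ ℂ) + C I * q.map (algebraMap ℝ ℂ) := by
  induction P using Polynomial.induction_on' with
  | add P Q hP hQ =>
    obtain ⟨p, q, rfl⟩ := hP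
    obtain ⟨r, s, rfl⟩ := hQ
    exact ⟨p + r, q + s, by simp; ring⟩
  | monomial k a =>
    refine ⟨monomial k a.re, monomial k a.im, ?_⟩
    rw [map_monomial, map_monomial, C_mul_monomial, ← map_add]
    congr 1
    simpa [mul_comm] using (re_add_im a).symm

lemma toCircle_mk_of_eq_prod {z : Fin n → ℂ} {v : Fin 2 → ℝ} (hv : v ≠ 0) (x : ℝ)
    (h : (v 0 : ℂ) + v 1 * I = (1 + I) * ∏ j, ((x : ℂ) - z j)) :
    toCircle (Projectivization.mk ℝ v hv) = I * ∏ j, factor (z j) x := by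
  rw [toCircle_mk, h, map_mul, map_prod, mul_div_mul_comm, ← Finset.prod_div_distrib]
  have h1 : (1 + I) / conj (1 + I) = I := by
    refine Eq.trans ?_ toCircle_basept
    rw [basept, toCircle_mk]
    simp
  rw [h1]
  congr 1
  refine Finset.prod_congr rfl fun j _ => ?_
  rw [factor_coe]
  simp

open Polynomial in
lemma aeval_ofReal (r : ℝ[X]) (x : ℝ) : aeval (x : ℂ) r = ((r.eval x : ℝ) : ℂ) :=
  aeval_algebraMap_apply_eq_algebraMap_eval x r

open Polynomial in
lemma loop_mem_RRat (z : NonrealTuple n) (hz : ∀ j k, conj (z.1 j) ≠ z.1 k) :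
    loop z ∈ RRat n 1 := by
  have hdeg : (∏ j, (X - C (z.1 j))).natDegree = n := by
    simp [natDegree_prod_of_monic _ _ fun j _ => monic_X_sub_C (z.1 j)]
  have hmon : (∏ j, (X - C (z.1 j))).Monic := monic_prod_of_monic _ _ fun j _ => monic_X_sub_C _
  obtain ⟨p, q, hpq⟩ := exists_re_im (C (1 + I) * ∏ j, (X - C (z.1 j)))
  have hcoeff : ∀ k, (1 + I) * (∏ j, (X - C (z.1 j))).coeff k = (p.coeff k : ℂ) + I * q.coeff k := by
    intro k
    rw [← coeff_C_mul, hpq]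
    simp
  have hn : p.coeff n = 1 ∧ q.coeff n = 1 := by
    have h := hcoeff n
    have h1 : (∏ j, (X - C (z.1 j))).coeff n = 1 :=
      (congrArg _ hdeg.symm).trans hmon
    rw [h1, mul_one] at h
    exact ⟨by simpa using (congrArg re h).symm, by simpa using (congrArg im h).symm⟩
  have hgt : ∀ k, n < k → p.coeff k = 0 ∧ q.coeff k = 0 := by
    intro k hk
    have h := hcoeff k
    rw [coeff_eq_zero_of_natDegree_lt (hdeg.trans_lt hk), mul_zero] at h
    exact ⟨by simpa using (congrArg re h).symm, by simpa using (congrArg im h).symm⟩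
  have hp : p.natDegree ≤ n := natDegree_le_iff_coeff_eq_zero.2 fun k hk => (hgt k hk).1
  have hq : q.natDegree ≤ n := natDegree_le_iff_coeff_eq_zero.2 fun k hk => (hgt k hk).2
  have heval : ∀ w : ℂ, (1 + I) * ∏ j, (w - z.1 j) = aeval w p + I * aeval w q := by
    intro w
    have := congrArg (eval w) hpq
    simpa [eval_prod, aeval_def, eval_map] using this
  have hroot : ∀ w : ℂ, aeval w p = 0 → aeval w q = 0 → ∃ j, w = z.1 j := by
    intro w h0 h1
    have h := heval w
    have hI : (1 : ℂ) + I ≠ 0 := by intro h; simpa using congrArg re h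
    rw [h0, h1, mul_zero, add_zero] at h
    obtain ⟨j, -, hj⟩ := Finset.prod_eq_zero_iff.1 ((mul_eq_zero.1 h).resolve_left hI)
    exact ⟨j, sub_eq_zero.1 hj⟩
  have hcop : ∀ w : ℂ, ¬ (aeval w p = 0 ∧ aeval w q = 0) := by
    rintro w ⟨h0, h1⟩
    obtain ⟨j, hj⟩ := hroot w h0 h1
    obtain ⟨k, hk⟩ := hroot (conj w) (by rw [aeval_conj, h0, map_zero])
      (by rw [aeval_conj, h1, map_zero])
    exact hz j k (by rw [← hj, hk])
  refine ⟨![p, q], ?_, ?_, fun w => ?_, fun x => ?_⟩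
  · exact Fin.forall_fin_two.2 ⟨monic_of_natDegree_le_of_coeff_eq_one n hp hn.1,
      monic_of_natDegree_le_of_coeff_eq_one n hq hn.2⟩
  · exact Fin.forall_fin_two.2 ⟨natDegree_eq_of_le_of_coeff_ne_zero hp (by simp [hn.1]),
      natDegree_eq_of_le_of_coeff_ne_zero hq (by simp [hn.2])⟩
  · by_contra! h
    exact hcop w ⟨h 0, h 1⟩
  · have hx : (fun i => (![p, q] i).eval x) ≠ 0 := by
      intro h
      refine hcop x ⟨?_, ?_⟩
      · rw [aeval_ofReal, ofReal_eq_zero]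
        exact congrFun h 0
      · rw [aeval_ofReal, ofReal_eq_zero]
        exact congrFun h 1
    refine ⟨hx, injective_toCircle ?_⟩
    rw [toCircle_loop, toCircle_mk_of_eq_prod (z := z.1) hx x]
    rw [heval, aeval_ofReal, aeval_ofReal]
    simp [mul_comm]

open Polynomial in
lemma RRat_subset_range_loop : RRat n 1 ⊆ Set.range (loop : NonrealTuple n → OmegaRP 1) := by
  rintro f ⟨p, hmon, hdeg, -, hf⟩
  set P : ℂ[X] := (p 0).map (algebraMap ℝ ℂ) + C I * (p 1).map (algebraMap ℝ ℂ) with hP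
  have hcoeff : ∀ k, P.coeff k = ((p 0).coeff k : ℂ) + I * (p 1).coeff k := fun k => by simp [hP]
  have hlead : ∀ i, (p i).coeff n = 1 := fun i => by
    conv_lhs => rw [← hdeg i]
    exact hmon i
  have hPn : P.coeff n = 1 + I := by simp [hcoeff, hlead]
  have hI : (1 : ℂ) + I ≠ 0 := by intro h; simpa using congrArg re h
  have hPdeg : P.natDegree = n := by
    refine natDegree_eq_of_le_of_coeff_ne_zero ?_ (by rwa [hPn])
    refine natDegree_le_iff_coeff_eq_zero.2 fun k hk => ?_
    simp [hcoeff, coeff_eq_zero_of_natDegree_lt ((hdeg _).trans_lt hk)]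
  have hPlead : P.leadingCoeff = 1 + I := by rw [leadingCoeff, hPdeg, hPn]
  have hcard : P.roots.toList.length = n := by
    rw [Multiset.length_toList, IsAlgClosed.card_roots_eq_natDegree, hPdeg]
  obtain ⟨z, hz⟩ : ∃ z : Fin n → ℂ, List.ofFn z = P.roots.toList := by
    subst hcard
    exact ⟨P.roots.toList.get, List.ofFn_get _⟩
  have hroots : P.roots = Multiset.ofList (List.ofFn z) := by rw [hz, Multiset.coe_toList]
  have hprod : P = C (1 + I) * ∏ j, (X - C (z j)) := by
    conv_lhs => rw [(IsAlgClosed.splits P).eq_prod_roots, hPlead, hroots]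
    simp [List.map_ofFn, List.prod_ofFn]
  have heval : ∀ x : ℝ, (((p 0).eval x : ℝ) : ℂ) + ((p 1).eval x : ℝ) * I =
      (1 + I) * ∏ j, ((x : ℂ) - z j) := by
    intro x
    have h1 : P.eval (x : ℂ) = (1 + I) * ∏ j, ((x : ℂ) - z j) := by
      rw [hprod]; simp [eval_prod]
    rw [← h1, hP]
    simp [aeval_ofReal, mul_comm]
  have him : ∀ j, (z j).im ≠ 0 := by
    intro j hj
    obtain ⟨hx, -⟩ := hf (z j).re
    have hzr : ((z j).re : ℂ) = z j := Complex.ext (by simp) (by simp [hj])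
    apply ofReal_add_mul_I_ne_zero hx
    rw [heval, Finset.prod_eq_zero (Finset.mem_univ j) (by rw [hzr, sub_self]), mul_zero]
  refine ⟨⟨z, him⟩, (eq_loop fun x => ?_).symm⟩
  obtain ⟨hx, hfx⟩ := hf x
  rw [hfx, toCircle_mk_of_eq_prod hx x (heval x)]

/-! ### The closure of the rational loops -/

lemma exists_tendsto_factor {α : Type*} (v : Ultrafilter α) {ζ : α → ℂ} (hζ : ∀ a, (ζ a).im ≠ 0)
    (h : ¬ ∃ w : ℂ, w.im ≠ 0 ∧ Tendsto ζ v (𝓝 w)) :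
    ∃ (κ : ℂ) (b : ℝ), ∀ x : ℝ, x ≠ b → Tendsto (fun a => factor (ζ a) x) v (𝓝 κ) := by
  have hc : Continuous (conj : ℂ → ℂ) := continuous_conj
  by_cases hw : ∃ w, Tendsto ζ v (𝓝 w)
  · obtain ⟨w, hw⟩ := hw
    have him : w.im = 0 := by
      by_contra him
      exact h ⟨w, him, hw⟩
    have hwr : ((w.re : ℝ) : ℂ) = w := Complex.ext (by simp) (by simp [him])
    refine ⟨1, w.re, fun x hx => ?_⟩
    have hne : (x : ℂ) - w ≠ 0 := by
      rw [← hwr, sub_ne_zero]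
      exact_mod_cast hx
    have hcw : conj w = w := by rw [← hwr, conj_ofReal]
    have h1 := (hw.const_sub (x : ℂ)).div (((hc.tendsto w).comp hw).const_sub (x : ℂ))
      (by rwa [hcw])
    rw [hcw, div_self hne] at h1
    exact h1.congr fun a => (factor_coe _ _).symm
  · have hcob : Tendsto ζ v (Bornology.cobounded ℂ) := by
      rw [Metric.cobounded_eq_cocompact]
      intro s hs
      obtain ⟨K, hK, hKs⟩ := mem_cocompact.1 hs
      refine mem_of_superset
        (Ultrafilter.compl_mem_iff_notMem.2 fun hKv => hw ?_ : Kᶜ ∈ v.map ζ) hKs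
      obtain ⟨w, -, hw⟩ := hK.ultrafilter_le_nhds' (v.map ζ) hKv
      exact ⟨w, hw⟩
    have hsph : ∀ᶠ a in v, factor (ζ a) (0 : ℝ) ∈ Metric.sphere (0 : ℂ) 1 :=
      Filter.Eventually.of_forall fun a => by simp [norm_factor (hζ a)]
    obtain ⟨κ, -, hκ⟩ := (isCompact_sphere (0 : ℂ) 1).ultrafilter_le_nhds'
      (v.map fun a => factor (ζ a) (0 : ℝ)) hsph
    refine ⟨κ, 0, fun x _ => ?_⟩
    have hinv : Tendsto (fun a => (ζ a)⁻¹) v (𝓝 0) := tendsto_inv₀_cobounded.comp hcob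
    have hinv' : Tendsto (fun a => conj (ζ a)⁻¹) v (𝓝 0) := by
      exact map_zero (starRingEnd ℂ) ▸ (hc.tendsto 0).comp hinv
    have hκ' : Tendsto (fun a => factor (ζ a) (0 : ℝ)) v (𝓝 κ) := hκ
    have h1 := hκ'.mul (((hinv.const_mul (x : ℂ)).sub_const 1).div
      ((hinv'.const_mul (x : ℂ)).sub_const 1) (by simp))
    rw [mul_zero, zero_sub, div_self (by simp), mul_one] at h1
    refine h1.congr fun a => ?_
    have hz : ζ a ≠ 0 := fun h0 => hζ a (by simp [h0])
    have hz' : conj (ζ a) ≠ 0 := (map_ne_zero _).2 hz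
    have h2 : (x : ℂ) - conj (ζ a) ≠ 0 := ofReal_sub_ne_zero (conj_im_ne_zero (hζ a)) x
    have h3 : (x : ℂ) * (conj (ζ a))⁻¹ - 1 ≠ 0 := by
      have : (x : ℂ) * (conj (ζ a))⁻¹ - 1 = (x - conj (ζ a)) / conj (ζ a) := by field_simp
      rw [this]
      exact div_ne_zero h2 hz'
    simp only [factor_coe, map_inv₀, Pi.div_apply, ofReal_zero]
    rw [div_mul_div_comm, div_eq_div_iff (mul_ne_zero (by simpa using hz') h3) h2]
    field_simp
    ring

lemma factor_sgn_mul_I (z : ℂ) (y : OnePoint ℝ) : factor (sgn z * I) y = factor I y ^ sgn z := by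
  unfold sgn
  split_ifs
  · simp
  · simpa using factor_neg_I y

lemma sgn_mul_I_im (z : ℂ) : ((sgn z : ℂ) * I).im ≠ 0 := by
  unfold sgn
  split_ifs <;> simp

lemma prod_factor_sgn_mul_I {ι : Type*} (s : Finset ι) (z : ι → ℂ) (y : OnePoint ℝ) :
    ∏ j ∈ s, factor (sgn (z j) * I) y = factor I y ^ ∑ j ∈ s, sgn (z j) := by
  classical
  induction s using Finset.induction_on with
  | empty => simp
  | insert i s hi ih =>
    rw [Finset.prod_insert hi, Finset.sum_insert hi, ih, factor_sgn_mul_I,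
      zpow_add₀ (factor_ne_zero (by simp) y)]

lemma eventually_sgn_eq {α : Type*} {l : Filter α} {ζ : α → ℂ} {w : ℂ} (hw : w.im ≠ 0)
    (h : Tendsto ζ l (𝓝 w)) : ∀ᶠ a in l, sgn (ζ a) = sgn w := by
  have him : Tendsto (fun a => (ζ a).im) l (𝓝 w.im) := (continuous_im.tendsto w).comp h
  rcases lt_or_gt_of_ne hw with hw | hw
  · filter_upwards [him.eventually_lt_const hw] with a ha
    rw [sgn_of_neg ha, sgn_of_neg hw]
  · filter_upwards [him.eventually_const_lt hw] with a ha
    rw [sgn_of_pos ha, sgn_of_pos hw]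

lemma isClosed_range_loop : IsClosed (Set.range (loop : NonrealTuple n → OmegaRP 1)) := by
  classical
  refine isClosed_of_closure_subset fun f hf => ?_
  have hne : NeBot (comap (loop : NonrealTuple n → OmegaRP 1) (𝓝 f)) := by
    refine comap_neBot_iff.2 fun t ht => ?_
    obtain ⟨_, h, a, rfl⟩ := mem_closure_iff_nhds.1 hf t ht
    exact ⟨a, h⟩
  set v := Ultrafilter.of (comap (loop : NonrealTuple n → OmegaRP 1) (𝓝 f))
  have hv : Tendsto (loop : NonrealTuple n → OmegaRP 1) v (𝓝 f) :=
    tendsto_iff_comap.2 (Ultrafilter.of_le _)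
  have hval : ∀ y, Tendsto (fun z : NonrealTuple n => I * ∏ j, factor (z.1 j) y) v
      (𝓝 (toCircle (f.1 y))) := by
    intro y
    have h1 : Continuous fun g : OmegaRP 1 => toCircle (g.1 y) :=
      continuous_toCircle.comp ((continuous_eval_const y).comp continuous_subtype_val)
    exact ((h1.tendsto f).comp hv).congr fun z => toCircle_loop z y
  let G : Finset (Fin n) := Finset.univ.filter fun j =>
    ∃ w : ℂ, w.im ≠ 0 ∧ Tendsto (fun z : NonrealTuple n => z.1 j) v (𝓝 w)
  have hG : ∀ j ∈ G, ∃ w : ℂ, w.im ≠ 0 ∧ Tendsto (fun z : NonrealTuple n => z.1 j) v (𝓝 w) :=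
    fun j hj => (Finset.mem_filter.1 hj).2
  have hB : ∀ j ∈ Gᶜ, ∃ (κ : ℂ) (b : ℝ), ∀ x : ℝ, x ≠ b →
      Tendsto (fun z : NonrealTuple n => factor (z.1 j) x) v (𝓝 κ) := by
    intro j hj
    refine exists_tendsto_factor v (fun z => z.2 j) fun h => Finset.mem_compl.1 hj ?_
    exact Finset.mem_filter.2 ⟨Finset.mem_univ j, h⟩
  choose! w hw hwt using hG
  choose! κ b hκ using hB
  have hoff : ∀ x : ℝ, x ∉ Gᶜ.image b → toCircle (f.1 x)
      = I * ((∏ j ∈ G, factor (w j) x) * ∏ j ∈ Gᶜ, κ j) := by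
    intro x hx
    refine tendsto_nhds_unique (hval x) ?_
    simp only [← Finset.prod_mul_prod_compl G]
    refine (Tendsto.mul ?_ ?_).const_mul I
    · refine tendsto_finsetProd _ fun j hj => ?_
      exact (continuousAt_factor (hw j hj) x).tendsto.comp
        ((hwt j hj).prodMk_nhds tendsto_const_nhds)
    · refine tendsto_finsetProd _ fun j hj => hκ j hj x ?_
      rintro rfl
      exact hx (Finset.mem_image_of_mem b hj)
  have hcont : Continuous fun y => I * ((∏ j ∈ G, factor (w j) y) * ∏ j ∈ Gᶜ, κ j) := by
    refine continuous_const.mul (Continuous.mul (continuous_finsetProd _ fun j hj => ?_)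
      continuous_const)
    exact continuous_iff_continuousAt.2 fun y =>
      (continuousAt_factor (hw j hj) y).comp (f := fun y => (w j, y)) (by fun_prop)
  have hdense : Dense ((fun x : ℝ => (x : OnePoint ℝ)) '' (Gᶜ.image b : Set ℝ)ᶜ) :=
    OnePoint.denseRange_coe.dense_image OnePoint.continuous_coe
      ((Gᶜ.image b).finite_toSet.countable.dense_compl ℝ)
  have hall : ∀ y, toCircle (f.1 y) = I * ((∏ j ∈ G, factor (w j) y) * ∏ j ∈ Gᶜ, κ j) := by
    refine congrFun ((continuous_toCircle_apply f).ext_on hdense hcont ?_)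
    rintro _ ⟨x, hx, rfl⟩
    exact hoff x fun h => hx (Finset.mem_coe.2 h)
  have hκ1 : ∏ j ∈ Gᶜ, κ j = 1 := by
    have h := hall ∞
    rw [f.2, toCircle_basept] at h
    simpa using h
  simp only [hκ1, mul_one] at hall
  have hfdeg : HasDeg (fun x => toCircle (f.1 x)) (∑ j ∈ G, sgn (w j)) := by
    simpa only [hall] using hasDeg_prod_factor G hw
  have hsgn : ∀ᶠ z : NonrealTuple n in v, ∀ j ∈ G, sgn (z.1 j) = sgn (w j) :=
    (Filter.eventually_all_finset G).2 fun j hj => eventually_sgn_eq (hw j hj) (hwt j hj)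
  obtain ⟨z, hzs, hzd⟩ := (hsgn.and (hv.eventually (eventually_hasDeg hfdeg))).exists
  have hbad : ∑ j ∈ Gᶜ, sgn (z.1 j) = 0 := by
    have h := (hasDeg_loop z).unique hzd
    rw [deg, ← Finset.sum_add_sum_compl G, Finset.sum_congr rfl hzs] at h
    linarith
  refine ⟨⟨fun j => if j ∈ G then w j else sgn (z.1 j) * I, fun j => ?_⟩, (eq_loop fun x => ?_).symm⟩
  · dsimp only
    split_ifs with hj
    · exact hw j hj
    · exact sgn_mul_I_im _
  · rw [hall, ← Finset.prod_mul_prod_compl G]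
    have h1 : ∏ j ∈ G, factor (if j ∈ G then w j else sgn (z.1 j) * I) x
        = ∏ j ∈ G, factor (w j) x :=
      Finset.prod_congr rfl fun j hj => by rw [if_pos hj]
    have h2 : ∏ j ∈ Gᶜ, factor (if j ∈ G then w j else sgn (z.1 j) * I) x
        = ∏ j ∈ Gᶜ, factor (sgn (z.1 j) * I) x :=
      Finset.prod_congr rfl fun j hj => by rw [if_neg (Finset.mem_compl.1 hj)]
    rw [h1, h2, prod_factor_sgn_mul_I, hbad, zpow_zero, mul_one]

/-- Points of the closure of `RRat n 1` are exactly the loops `loop z`. -/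
lemma ratSet_eq_range_loop : ratSet n 1 = Set.range (loop : NonrealTuple n → OmegaRP 1) := by
  refine subset_antisymm (closure_minimal RRat_subset_range_loop isClosed_range_loop) ?_
  rintro _ ⟨z, rfl⟩
  let s : ℝ → Fin n → ℂ := fun t j => z.1 j + t * I
  have hs : Continuous s := by fun_prop
  have hs0 : s 0 = z.1 := by ext j; simp [s]
  have him : ∀ᶠ t in 𝓝 (0 : ℝ), ∀ j, (s t j).im ≠ 0 := by
    refine eventually_all.2 fun j => ?_
    have : Continuous fun t => (s t j).im := by fun_prop
    exact this.continuousAt.eventually_ne (by simpa [hs0] using z.2 j)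
  have hconj : ∀ᶠ t in 𝓝[>] (0 : ℝ), ∀ j k, conj (s t j) ≠ s t k := by
    refine eventually_all.2 fun j => eventually_all.2 fun k => ?_
    have hne : ∀ᶠ t in 𝓝[>] (0 : ℝ), t ≠ -((z.1 j).im + (z.1 k).im) / 2 := by
      by_cases h : -((z.1 j).im + (z.1 k).im) / 2 = 0
      · rw [h]
        filter_upwards [self_mem_nhdsWithin] with t ht using ne_of_gt ht
      · exact (nhdsWithin_le_nhds (isOpen_ne.mem_nhds (Ne.symm h)))
    filter_upwards [hne] with t ht h
    apply ht
    have := congrArg im h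
    simp [s] at this
    linarith
  let r : ℝ → NonrealTuple n := fun t =>
    if h : ∀ j, (s t j).im ≠ 0 then ⟨s t, h⟩ else z
  have hr : Tendsto r (𝓝[>] 0) (𝓝 z) := by
    rw [tendsto_subtype_rng]
    have h0 : Tendsto s (𝓝[>] 0) (𝓝 z.1) := hs0 ▸ (hs.tendsto 0).mono_left nhdsWithin_le_nhds
    refine h0.congr' ?_
    filter_upwards [nhdsWithin_le_nhds him] with t ht
    simp only [r, dif_pos ht]
  refine mem_closure_of_tendsto ((continuous_loop.tendsto z).comp hr) ?_
  filter_upwards [nhdsWithin_le_nhds him, hconj] with t ht htc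
  refine loop_mem_RRat _ ?_
  simpa only [r, dif_pos ht] using htc

/-! ### Counting path components -/

/-- The loop `loop z` as a point of `ratSet n 1`. -/
def ratLoop (z : NonrealTuple n) : ratSet n 1 :=
  ⟨loop z, ratSet_eq_range_loop ▸ Set.mem_range_self z⟩

lemma continuous_ratLoop : Continuous (ratLoop : NonrealTuple n → ratSet n 1) :=
  continuous_loop.subtype_mk _

lemma surjective_ratLoop : Function.Surjective (ratLoop : NonrealTuple n → ratSet n 1) := by
  rintro ⟨f, hf⟩
  obtain ⟨z, rfl⟩ := ratSet_eq_range_loop ▸ hf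
  exact ⟨z, rfl⟩

/-- The tuple with entries `± i` in the same half-planes as those of `z`. -/
def standardize (z : NonrealTuple n) : NonrealTuple n :=
  ⟨fun j => sgn (z.1 j) * I, fun _ => sgn_mul_I_im _⟩

lemma joined_standardize (z : NonrealTuple n) : Joined z (standardize z) := by
  have him : ∀ (t : unitInterval) j,
      ((1 - (t : ℝ) : ℂ) * z.1 j + (t : ℝ) * (sgn (z.1 j) * I)).im ≠ 0 := by
    intro t j
    have h0 := t.2.1
    have h1 := t.2.2
    rcases lt_or_gt_of_ne (z.2 j) with h | h
    · rw [sgn_of_neg h]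
      rcases h1.eq_or_lt with h1 | h1
      · simp [h1]
      · have := mul_neg_of_pos_of_neg (sub_pos.2 h1) h
        simp
        linarith
    · rw [sgn_of_pos h]
      rcases h1.eq_or_lt with h1 | h1
      · simp [h1]
      · have := mul_pos (sub_pos.2 h1) h
        simp
        linarith
  refine ⟨⟨⟨fun t => ⟨fun j => (1 - (t : ℝ) : ℂ) * z.1 j + (t : ℝ) * (sgn (z.1 j) * I), him t⟩,
    ?_⟩, ?_, ?_⟩⟩
  · refine Continuous.subtype_mk (continuous_pi fun j => ?_) _
    have : Continuous fun t : unitInterval => ((t : ℝ) : ℂ) :=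
      continuous_ofReal.comp continuous_subtype_val
    fun_prop
  · ext j; simp
  · ext j; simp [standardize]

lemma joined_ratLoop {z w : NonrealTuple n} (h : deg z = deg w) :
    Joined (ratLoop z) (ratLoop w) := by
  have key : ratLoop (standardize z) = ratLoop (standardize w) := by
    refine Subtype.ext (eq_loop fun x => ?_)
    have hp (u : NonrealTuple n) :
        ∏ j, factor ((standardize u).1 j) x = factor I x ^ deg u :=
      prod_factor_sgn_mul_I _ _ _
    rw [hp, ← h, ← hp]
    exact toCircle_loop _ _
  have hz := (joined_standardize z).map continuous_ratLoop
  have hw := (joined_standardize w).map continuous_ratLoop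
  rw [key] at hz
  exact hz.trans hw.symm

lemma deg_eq_of_joined {z w : NonrealTuple n} (h : Joined (ratLoop z) (ratLoop w)) :
    deg z = deg w := by
  choose r hr using surjective_ratLoop (n := n)
  have hd : ∀ f : ratSet n 1, HasDeg (fun x => toCircle (f.1.1 x)) (deg (r f)) := fun f => by
    conv in f.1.1 => rw [← hr f]
    exact hasDeg_loop (r f)
  have hc : Continuous fun f : ratSet n 1 => deg (r f) := by
    refine continuous_iff_continuousAt.2 fun f => ?_
    rw [ContinuousAt, nhds_discrete ℤ, tendsto_pure]
    filter_upwards [continuous_subtype_val.continuousAt.eventually (eventually_hasDeg (hd f))]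
      with g hg
    exact (hd g).unique hg
  obtain ⟨γ⟩ := h
  have h01 := PreconnectedSpace.constant inferInstance (hc.comp γ.continuous) (x := 0) (y := 1)
  simp only [Function.comp, γ.source, γ.target] at h01
  rw [(hasDeg_loop z).unique (hd (ratLoop z)), (hasDeg_loop w).unique (hd (ratLoop w)), h01]

/-- The tuple with `k` entries `i` followed by `n - k` entries `-i`. -/
def stdTuple (n : ℕ) (k : Fin (n + 1)) : NonrealTuple n :=
  ⟨fun j => if (j : ℕ) < k then I else -I, fun j => by dsimp only; split_ifs <;> simp⟩

lemma sum_ite_sgn {ι : Type*} [Fintype ι] (p : ι → Prop) [DecidablePred p] :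
    ∑ j, (if p j then (1 : ℤ) else -1) =
      2 * (Finset.univ.filter p).card - Fintype.card ι := by
  have h : ∀ j, (if p j then (1 : ℤ) else -1) = 2 * (if p j then 1 else 0) - 1 := fun j => by
    split_ifs <;> norm_num
  simp only [h, Finset.sum_sub_distrib, ← Finset.mul_sum, Finset.sum_boole]
  simp

lemma deg_eq (z : NonrealTuple n) :
    deg z = 2 * (Finset.univ.filter fun j => 0 < (z.1 j).im).card - n := by
  simpa [deg, sgn] using sum_ite_sgn fun j => 0 < (z.1 j).im

lemma deg_stdTuple (k : Fin (n + 1)) : deg (stdTuple n k) = 2 * (k : ℕ) - n := by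
  have h : (Finset.univ.filter fun j => 0 < ((stdTuple n k).1 j).im)
      = Finset.univ.filter fun j : Fin n => (j : ℕ) < k := by
    ext j
    rw [Finset.mem_filter_univ, Finset.mem_filter_univ]
    by_cases hj : (j : ℕ) < k <;> simp [stdTuple, hj]
  rw [deg_eq, h, Fin.card_filter_val_lt, min_eq_right (Nat.lt_succ_iff.1 k.2)]

end RatLoop

/-- For every `n ≥ 1`, the space `rat(n,1)` has exactly `n + 1` path components. -/
theorem ratSet_n1_card_path_components (n : ℕ) (hn : 1 ≤ n) :
    Nat.card (ZerothHomotopy ↥(ratSet n 1)) = n + 1 := by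
  have hbij : Function.Bijective fun k : Fin (n + 1) =>
      ZerothHomotopy.mk (RatLoop.ratLoop (RatLoop.stdTuple n k)) := by
    constructor
    · intro k l h
      have := RatLoop.deg_eq_of_joined (Quotient.exact h)
      rw [RatLoop.deg_stdTuple, RatLoop.deg_stdTuple] at this
      exact Fin.ext (by omega)
    · intro c
      obtain ⟨f, rfl⟩ := Quotient.exists_rep c
      obtain ⟨z, rfl⟩ := RatLoop.surjective_ratLoop f
      have hcard := Finset.card_le_univ (Finset.univ.filter fun j => 0 < (z.1 j).im)
      rw [Fintype.card_fin] at hcard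
      refine ⟨⟨_, Nat.lt_succ_iff.2 hcard⟩, Quotient.sound (RatLoop.joined_ratLoop ?_)⟩
      rw [RatLoop.deg_stdTuple, RatLoop.deg_eq]
  rw [← Nat.card_eq_of_bijective _ hbij, Nat.card_eq_fintype_card, Fintype.card_fin]

end
end

section
/- For every n ≥ 1, every path component of rat(n,1) is contractible. -/
open OnePoint Projectivization

noncomputable section

open Complex Set Filter Topology

lemma isInducing_coe_circle : IsInducing (fun z : Circle => (z : ℂ)) := ⟨rfl⟩

/-- The point `(x₀ + i x₁)² / |x₀ + i x₁|²` of the circle, rotated so that `(1, 1)` is sent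
to `1`. -/
def circleOfVec (v : {v : Fin 2 → ℝ // v ≠ 0}) : Circle :=
  Circle.ofConjDivSelf ((1 + I) * (v.1 0 - v.1 1 * I)) (by
    refine mul_ne_zero (fun h => by simpa using congrArg re h) fun h => v.2 ?_
    ext i
    fin_cases i
    · simpa using congrArg re h
    · simpa using congrArg im h)

lemma sub_mul_I_ne_zero_of_vec {v : Fin 2 → ℝ} (hv : v ≠ 0) : (v 0 : ℂ) - v 1 * I ≠ 0 := by
  intro h
  apply hv
  ext i
  fin_cases i
  · simpa using congrArg re h
  · simpa using congrArg im h

lemma one_add_I_ne_zero : (1 + I : ℂ) ≠ 0 := fun h => by simpa using congrArg re h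

lemma one_sub_I_ne_zero : (1 - I : ℂ) ≠ 0 := fun h => by simpa using congrArg re h

lemma coe_circleOfVec (v : {v : Fin 2 → ℝ // v ≠ 0}) :
    (circleOfVec v : ℂ) = ((v.1 0 + v.1 1 * I) / (1 + I)) / ((v.1 0 - v.1 1 * I) / (1 - I)) := by
  have h1 := sub_mul_I_ne_zero_of_vec v.2
  have h2 := one_add_I_ne_zero
  have h3 := one_sub_I_ne_zero
  simp only [circleOfVec, Circle.ofConjDivSelf, map_mul, map_add, map_sub, map_one, conj_I,
    conj_ofReal]
  field_simp
  ring

lemma continuous_circleOfVec : Continuous circleOfVec := by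
  refine isInducing_coe_circle.continuous_iff.2 ?_
  change Continuous fun v => (circleOfVec v : ℂ)
  simp only [coe_circleOfVec]
  have hc (i : Fin 2) : Continuous fun v : {v : Fin 2 → ℝ // v ≠ 0} => (v.1 i : ℂ) :=
    continuous_ofReal.comp ((continuous_apply i).comp continuous_subtype_val)
  exact (((hc 0).add ((hc 1).mul_const I)).div_const _).div
    (((hc 0).sub ((hc 1).mul_const I)).div_const _)
    fun v => div_ne_zero (sub_mul_I_ne_zero_of_vec v.2) one_sub_I_ne_zero

lemma circleOfVec_smul (a b : {v : Fin 2 → ℝ // v ≠ 0}) (t : ℝ) (h : a.1 = t • b.1) :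
    circleOfVec a = circleOfVec b := by
  have ht : (t : ℂ) ≠ 0 := by
    rintro h0
    have : t = 0 := by exact_mod_cast h0
    exact a.2 (by simp [h, this])
  have h1 := sub_mul_I_ne_zero_of_vec b.2
  have h3 := one_sub_I_ne_zero
  ext
  rw [coe_circleOfVec, coe_circleOfVec, h]
  simp only [Pi.smul_apply, smul_eq_mul, ofReal_mul]
  rw [show (t : ℂ) * b.1 0 + t * b.1 1 * I = t * (b.1 0 + b.1 1 * I) by ring,
    show (t : ℂ) * b.1 0 - t * b.1 1 * I = t * (b.1 0 - b.1 1 * I) by ring]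
  field_simp

/-- The map from the real projective line to the circle induced by `circleOfVec`. -/
def circleOfRP : RP 1 → Circle := Projectivization.lift circleOfVec circleOfVec_smul

lemma continuous_circleOfRP : Continuous circleOfRP :=
  Continuous.quotient_lift continuous_circleOfVec _

lemma circleOfRP_injective : Function.Injective circleOfRP := by
  intro x y
  induction x using Projectivization.ind with | h v hv
  induction y using Projectivization.ind with | h w hw
  intro h
  change circleOfVec ⟨v, hv⟩ = circleOfVec ⟨w, hw⟩ at h
  have h := congrArg (fun z : Circle => (z : ℂ)) h
  simp only [coe_circleOfVec] at h
  have hv1 := sub_mul_I_ne_zero_of_vec hv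
  have hw1 := sub_mul_I_ne_zero_of_vec hw
  have h2 := one_add_I_ne_zero
  have h3 := one_sub_I_ne_zero
  rw [div_eq_div_iff (div_ne_zero hv1 h3) (div_ne_zero hw1 h3)] at h
  field_simp at h
  have h4 := congrArg im h
  simp at h4
  rw [Projectivization.mk_eq_mk_iff']
  have hpos : w 0 ^ 2 + w 1 ^ 2 ≠ 0 := by
    intro h0
    apply hw
    ext i
    fin_cases i
    · simp only [Fin.zero_eta, Pi.zero_apply]; nlinarith
    · simp only [Fin.mk_one, Pi.zero_apply]; nlinarith
  refine ⟨(v 0 * w 0 + v 1 * w 1) / (w 0 ^ 2 + w 1 ^ 2), ?_⟩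
  ext i
  fin_cases i
  · simp only [Fin.zero_eta, Pi.smul_apply, smul_eq_mul]
    field_simp
    linear_combination (w 1 / 2) * h4
  · simp only [Fin.mk_one, Pi.smul_apply, smul_eq_mul]
    field_simp
    linear_combination (-w 0 / 2) * h4

lemma cos_sin_ne_zero (θ : ℝ) : (![Real.cos θ, Real.sin θ] : Fin 2 → ℝ) ≠ 0 := by
  intro h
  have h0 : Real.cos θ = 0 := by simpa using congrFun h 0
  have h1 : Real.sin θ = 0 := by simpa using congrFun h 1
  nlinarith [Real.sin_sq_add_cos_sq θ]

/-- The line in the plane with angle `θ`. -/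
def lineOfAngle (θ : ℝ) : RP 1 := Projectivization.mk ℝ _ (cos_sin_ne_zero θ)

lemma continuous_lineOfAngle : Continuous lineOfAngle := by
  have : Continuous fun θ : ℝ =>
      (⟨_, cos_sin_ne_zero θ⟩ : {v : Fin 2 → ℝ // v ≠ 0}) := by
    refine Continuous.subtype_mk (continuous_pi fun i => ?_) _
    fin_cases i
    · simpa using Real.continuous_cos
    · simpa using Real.continuous_sin
  exact continuous_quotient_mk'.comp this

lemma circleOfRP_lineOfAngle (θ : ℝ) :
    circleOfRP (lineOfAngle (θ / 2 + Real.pi / 4)) = Circle.exp θ := by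
  ext
  change (circleOfVec ⟨_, _⟩ : ℂ) = _
  rw [coe_circleOfVec, Circle.coe_exp]
  set α := θ / 2 + Real.pi / 4 with hα
  simp only [Matrix.cons_val_zero, Matrix.cons_val_one]
  have e1 : (Real.cos α : ℂ) + Real.sin α * I = exp (α * I) := by
    rw [exp_mul_I, ofReal_cos, ofReal_sin]
  have e2 : (Real.cos α : ℂ) - Real.sin α * I = exp (-(α * I)) := by
    rw [← neg_mul, exp_mul_I, ofReal_cos, ofReal_sin, cos_neg, sin_neg]; ring
  have e3 : exp (Real.pi / 2 * I) = I := exp_pi_div_two_mul_I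
  have h2 := one_add_I_ne_zero
  have h3 := one_sub_I_ne_zero
  have e4 : (1 + I) = I * (1 - I) := by ring_nf; simp [I_sq]; ring
  have e5 : exp (α * I) = exp (θ * I) * exp (Real.pi / 2 * I) * exp (-(α * I)) := by
    rw [← exp_add, ← exp_add]
    congr 1
    rw [hα]; push_cast; ring
  have h6 := exp_ne_zero (-(α * I))
  rw [e1, e2, e4, e5, e3]
  field_simp

/-- The real projective line is a circle, with `[1 : 1]` corresponding to `1`. -/
def homeoRP : RP 1 ≃ₜ Circle where
  toFun := circleOfRP
  invFun z := lineOfAngle (arg z / 2 + Real.pi / 4)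
  left_inv x := circleOfRP_injective (by rw [circleOfRP_lineOfAngle, Circle.exp_arg])
  right_inv z := by rw [circleOfRP_lineOfAngle, Circle.exp_arg]
  continuous_toFun := continuous_circleOfRP
  continuous_invFun := by
    rw [(Circle.isCoveringMap_exp.isQuotientMap Circle.exp_surjective).continuous_iff]
    have : ((fun z : Circle => lineOfAngle (arg z / 2 + Real.pi / 4)) ∘ Circle.exp) =
        fun θ : ℝ => lineOfAngle (θ / 2 + Real.pi / 4) := by
      ext1 θ
      apply circleOfRP_injective
      simp only [Function.comp_apply]
      rw [circleOfRP_lineOfAngle, circleOfRP_lineOfAngle, Circle.exp_arg]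
    rw [this]
    exact continuous_lineOfAngle.comp (by fun_prop)

lemma coe_homeoRP_mk (v : Fin 2 → ℝ) (hv : v ≠ 0) :
    (homeoRP (Projectivization.mk ℝ v hv) : ℂ) =
      ((v 0 + v 1 * I) / (1 + I)) / ((v 0 - v 1 * I) / (1 - I)) :=
  coe_circleOfVec ⟨v, hv⟩

lemma homeoRP_basept : homeoRP (basept 1) = 1 := by
  ext
  rw [basept, coe_homeoRP_mk]
  simp [div_self, one_add_I_ne_zero, one_sub_I_ne_zero]

lemma ofReal_add_I_ne_zero (x : ℝ) : (x : ℂ) + I ≠ 0 := fun h => by simpa using congrArg im h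

/-- The Cayley transform from the projective line `ℝ ∪ {∞}` to the circle. -/
def cayley : OnePoint ℝ → Circle
  | ∞ => 1
  | (x : ℝ) => Circle.ofConjDivSelf (x + I) (ofReal_add_I_ne_zero x)

lemma cayley_infty : cayley ∞ = 1 := rfl

lemma coe_cayley (x : ℝ) : (cayley x : ℂ) = (x - I) / (x + I) := by
  change (starRingEnd ℂ) (x + I) / (x + I) = _
  simp [sub_eq_add_neg]

lemma cayley_ne_one (x : ℝ) : (cayley x : ℂ) ≠ 1 := by
  rw [coe_cayley, Ne, div_eq_one_iff_eq (ofReal_add_I_ne_zero x)]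
  intro h
  have := congrArg im h
  norm_num at this

lemma continuous_cayley : Continuous cayley := by
  rw [OnePoint.continuous_iff]
  constructor
  · rw [cayley_infty, isInducing_coe_circle.tendsto_nhds_iff]
    change Tendsto (fun x : ℝ => (cayley x : ℂ)) _ (𝓝 ((1 : Circle) : ℂ))
    have h : (fun x : ℝ => (cayley x : ℂ)) = fun x : ℝ => 1 - 2 * I * ((x : ℂ) + I)⁻¹ := by
      ext x
      have := ofReal_add_I_ne_zero x
      rw [coe_cayley]
      field_simp
      ring
    rw [h, Circle.coe_one, coclosedCompact_eq_cocompact]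
    have h2 : Tendsto (fun x : ℝ => ((x : ℂ) + I)⁻¹) (cocompact ℝ) (𝓝 0) := by
      refine tendsto_inv₀_cobounded.comp ?_
      rw [← tendsto_norm_atTop_iff_cobounded]
      refine tendsto_atTop_mono (fun x => ?_) (tendsto_norm_cocompact_atTop (E := ℝ))
      calc ‖x‖ = |((x : ℂ) + I).re| := by simp
        _ ≤ _ := abs_re_le_norm _
    simpa using (tendsto_const_nhds (x := (1 : ℂ))).sub (h2.const_mul (2 * I))
  · refine isInducing_coe_circle.continuous_iff.2 ?_
    change Continuous fun x : ℝ => (cayley x : ℂ)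
    simp only [coe_cayley]
    exact Continuous.div (by fun_prop) (by fun_prop) ofReal_add_I_ne_zero

lemma cayley_bijective : Function.Bijective cayley := by
  constructor
  · intro x y h
    induction x using OnePoint.rec with
    | infty =>
      induction y using OnePoint.rec with
      | infty => rfl
      | coe y => exact absurd (congrArg (fun z : Circle => (z : ℂ)) h).symm (cayley_ne_one y)
    | coe x =>
      induction y using OnePoint.rec with
      | infty => exact absurd (congrArg (fun z : Circle => (z : ℂ)) h) (cayley_ne_one x)
      | coe y =>
        have h := congrArg (fun z : Circle => (z : ℂ)) h
        simp only [coe_cayley] at h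
        rw [div_eq_div_iff (ofReal_add_I_ne_zero x) (ofReal_add_I_ne_zero y)] at h
        have := congrArg im h
        simp at this
        congr 1
        linarith
  · intro z
    by_cases hz : z = 1
    · exact ⟨∞, hz.symm⟩
    refine ⟨((-(z : ℂ).im / (1 - (z : ℂ).re) : ℝ) : OnePoint ℝ), ?_⟩
    have hn := Circle.normSq_coe z
    rw [normSq_apply] at hn
    have hre : 1 - (z : ℂ).re ≠ 0 := by
      intro h
      have h1 : (z : ℂ).re = 1 := by linarith
      have h2 : (z : ℂ).im = 0 := by rw [h1] at hn; nlinarith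
      exact hz (Circle.ext (Complex.ext (by simpa using h1) (by simpa using h2)))
    ext
    rw [coe_cayley, div_eq_iff (ofReal_add_I_ne_zero _)]
    have hx := div_mul_cancel₀ (-(z : ℂ).im) hre
    generalize -(z : ℂ).im / (1 - (z : ℂ).re) = x at hx ⊢
    apply Complex.ext
    · simp
      linear_combination hx
    · simp
      apply mul_right_cancel₀ hre
      linear_combination (-(z : ℂ).im) * hx + hn

/-- The Cayley transform as a homeomorphism. -/
def homeoOnePoint : OnePoint ℝ ≃ₜ Circle :=
  continuous_cayley.homeoOfEquivCompactToT2 (f := Equiv.ofBijective cayley cayley_bijective)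

lemma homeoOnePoint_apply (x : OnePoint ℝ) : homeoOnePoint x = cayley x := rfl

lemma isQuotientMap_circleExp : IsQuotientMap Circle.exp :=
  Circle.isCoveringMap_exp.isQuotientMap Circle.exp_surjective

lemma circle_lift_unique {F G : C(ℝ, ℝ)} (hF : F 0 = 0) (hG : G 0 = 0)
    (h : ∀ θ, Circle.exp (F θ) = Circle.exp (G θ)) : F = G := by
  refine (Circle.isCoveringMap_exp.existsUnique_continuousMap_lifts (Circle.exp.comp G) 0 0
    (by simp [hG])).unique ⟨hF, funext h⟩ ⟨hG, rfl⟩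

/-- Every self-map of the circle is, up to a rotation, the product of a power map and of the
exponential of a real-valued function. -/
lemma exists_deg_phase (g : C(Circle, Circle)) :
    ∃ p : ℤ × C(Circle, ℝ), p.2 1 = 0 ∧ ∀ z, g z = g 1 * z ^ p.1 * Circle.exp (p.2 z) := by
  let f : C(ℝ, Circle) := ⟨fun θ => g (Circle.exp θ) / g 1, by fun_prop⟩
  obtain ⟨F, ⟨hF0, hF⟩, -⟩ := Circle.isCoveringMap_exp.existsUnique_continuousMap_lifts f 0 0
    (by simp [f])
  replace hF (θ : ℝ) : Circle.exp (F θ) = g (Circle.exp θ) / g 1 := congrFun hF θ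
  have hF1 : Circle.exp (F (2 * Real.pi)) = 1 := by rw [hF]; simp
  have hper (θ : ℝ) : F (θ + 2 * Real.pi) = F θ + F (2 * Real.pi) := by
    let G : C(ℝ, ℝ) := ⟨fun θ => F (θ + 2 * Real.pi) - F (2 * Real.pi), by fun_prop⟩
    have : G = F := circle_lift_unique (by simp [G]) hF0 fun θ => by
      simp only [G, ContinuousMap.coe_mk]
      rw [Circle.exp_sub, hF1, div_one, hF, hF, Circle.exp_add_two_pi]
    have h := congrArg (fun k : C(ℝ, ℝ) => k θ) this
    simp only [G, ContinuousMap.coe_mk] at h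
    linarith
  obtain ⟨d, hd⟩ := Circle.exp_eq_one.1 hF1
  let Φ : C(ℝ, ℝ) := ⟨fun θ => F θ - d * θ, by fun_prop⟩
  have hΦ : Function.Periodic Φ (2 * Real.pi) := fun θ => by
    simp only [Φ, ContinuousMap.coe_mk, hper, hd]
    ring
  have hlift : ∀ a b, Circle.exp a = Circle.exp b → Φ a = Φ b := by
    intro a b hab
    obtain ⟨m, rfl⟩ := Circle.exp_eq_exp.1 hab
    exact hΦ.int_mul m b
  let φ : C(Circle, ℝ) := isQuotientMap_circleExp.lift Φ hlift
  have hφ (θ : ℝ) : φ (Circle.exp θ) = F θ - d * θ :=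
    congrArg (fun k : C(ℝ, ℝ) => k θ) (isQuotientMap_circleExp.lift_comp Φ hlift)
  refine ⟨(d, φ), ?_, fun z => ?_⟩
  · have := hφ 0
    simpa [hF0] using this
  · obtain ⟨θ, rfl⟩ := Circle.exp_surjective z
    simp only
    rw [hφ, Circle.exp_sub, hF, Circle.exp_intCast_mul]
    simp [mul_comm]

lemma deg_phase_unique {d e : ℤ} {φ ψ : C(Circle, ℝ)} (hφ : φ 1 = 0) (hψ : ψ 1 = 0)
    (h : ∀ z : Circle, z ^ d * Circle.exp (φ z) = z ^ e * Circle.exp (ψ z)) :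
    d = e ∧ φ = ψ := by
  let F : C(ℝ, ℝ) := ⟨fun θ => d * θ + φ (Circle.exp θ), by fun_prop⟩
  let G : C(ℝ, ℝ) := ⟨fun θ => e * θ + ψ (Circle.exp θ), by fun_prop⟩
  have hFG : F = G := circle_lift_unique (by simp [F, hφ]) (by simp [G, hψ]) fun θ => by
    simpa [F, G, Circle.exp_add] using h (Circle.exp θ)
  have hFG' (θ : ℝ) : d * θ + φ (Circle.exp θ) = e * θ + ψ (Circle.exp θ) :=
    congrArg (fun k : C(ℝ, ℝ) => k θ) hFG
  have hde : d = e := by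
    have := hFG' (2 * Real.pi)
    rw [Circle.exp_two_pi, hφ, hψ, add_zero, add_zero] at this
    exact_mod_cast mul_right_cancel₀ Real.two_pi_pos.ne' this
  refine ⟨hde, ?_⟩
  ext z
  obtain ⟨θ, rfl⟩ := Circle.exp_surjective z
  have := hFG' θ
  rw [hde] at this
  exact add_left_cancel this

/-- The degree of a self-map of the circle. -/
def circleDeg (g : C(Circle, Circle)) : ℤ := (exists_deg_phase g).choose.1

/-- The logarithm of `z ↦ g z / (g 1 * z ^ circleDeg g)` vanishing at `1`. -/
def circlePhase (g : C(Circle, Circle)) : C(Circle, ℝ) := (exists_deg_phase g).choose.2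

lemma circlePhase_one (g : C(Circle, Circle)) : circlePhase g 1 = 0 :=
  (exists_deg_phase g).choose_spec.1

lemma eq_zpow_mul_exp_phase (g : C(Circle, Circle)) (z : Circle) :
    g z = g 1 * z ^ circleDeg g * Circle.exp (circlePhase g z) :=
  (exists_deg_phase g).choose_spec.2 z

lemma circleDeg_circlePhase_eq {g : C(Circle, Circle)} {d : ℤ} {φ : C(Circle, ℝ)} (hφ : φ 1 = 0)
    (h : ∀ z, g z = g 1 * z ^ d * Circle.exp (φ z)) : circleDeg g = d ∧ circlePhase g = φ :=
  deg_phase_unique (circlePhase_one g) hφ fun z => by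
    have := (eq_zpow_mul_exp_phase g z).symm.trans (h z)
    rwa [mul_assoc, mul_assoc, mul_right_inj] at this

lemma eventually_deg_phase (g : C(Circle, Circle)) : ∀ᶠ g' in 𝓝 g, circleDeg g' = circleDeg g ∧
    ∀ z, circlePhase g' z =
      circlePhase g z + (arg ((g' z / g z : Circle) : ℂ) - arg ((g' 1 / g 1 : Circle) : ℂ)) := by
  let U : Set C(Circle, Circle) :=
    {k | MapsTo (k / g) univ {w : Circle | (w : ℂ) ∈ slitPlane}}
  have hU : IsOpen U :=
    (ContinuousMap.isOpen_setOfPred_mapsTo isCompact_univ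
      (isOpen_slitPlane.preimage isInducing_coe_circle.continuous)).preimage
      (continuous_id.div' continuous_const : Continuous fun k : C(Circle, Circle) => k / g)
  have hgU : g ∈ U := fun z _ => by simp
  filter_upwards [hU.mem_nhds hgU] with k hk
  let a : C(Circle, ℝ) := ⟨fun z => arg ((k z / g z : Circle) : ℂ), by
    refine continuous_iff_continuousAt.2 fun z => ?_
    refine ContinuousAt.comp (f := fun z => ((k z / g z : Circle) : ℂ))
      (continuousAt_arg (hk (mem_univ z))) ?_
    exact (isInducing_coe_circle.continuous.comp (k / g).continuous).continuousAt⟩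
  let ψ : C(Circle, ℝ) := circlePhase g + (a - ContinuousMap.const _ (a 1))
  have h := circleDeg_circlePhase_eq (g := k) (d := circleDeg g) (φ := ψ)
    (by simp [ψ, circlePhase_one]) fun z => by
      simp only [ψ, a, ContinuousMap.add_apply, ContinuousMap.sub_apply, ContinuousMap.const_apply,
        ContinuousMap.coe_mk, Circle.exp_add, Circle.exp_sub, Circle.exp_arg]
      have := eq_zpow_mul_exp_phase g z
      calc k z = (k 1 / (k 1 / g 1)) * (k z / g z) * (g z / g 1) := by
            simp [div_eq_mul_inv, mul_comm, mul_left_comm]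
        _ = _ := by
            rw [this]
            generalize z ^ circleDeg g = w
            ext
            simp only [Circle.coe_mul, Circle.coe_div]
            field_simp [Circle.coe_ne_zero]
  exact ⟨h.1, fun z => by rw [h.2]; rfl⟩

lemma continuous_circleDeg : Continuous circleDeg := by
  refine continuous_iff_continuousAt.2 fun g => ?_
  exact continuousAt_const.congr ((eventually_deg_phase g).mono fun k hk => hk.1.symm)

lemma continuous_circlePhase : Continuous circlePhase := by
  refine ContinuousMap.continuous_of_continuous_uncurry _ (continuous_iff_continuousAt.2 ?_)
  rintro ⟨g, z⟩
  have harg (u : C(Circle, Circle) × Circle → Circle) (hu : Continuous u) :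
      ContinuousAt (fun p => arg ((p.1 (u p) / g (u p) : Circle) : ℂ)) (g, z) := by
    refine ContinuousAt.comp (f := fun p : C(Circle, Circle) × Circle =>
      ((p.1 (u p) / g (u p) : Circle) : ℂ)) (continuousAt_arg (by simp)) ?_
    refine (isInducing_coe_circle.continuous.comp ?_).continuousAt
    fun_prop
  refine ContinuousAt.congr (f := fun p : C(Circle, Circle) × Circle => circlePhase g p.2 +
    (arg ((p.1 p.2 / g p.2 : Circle) : ℂ) - arg ((p.1 1 / g 1 : Circle) : ℂ))) ?_ ?_
  · exact ((circlePhase g).continuous.comp continuous_snd).continuousAt.add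
      ((harg _ continuous_snd).sub (harg _ continuous_const))
  · filter_upwards [(continuous_fst.tendsto (g, z)).eventually (eventually_deg_phase g)] with p hp
    exact (hp.2 p.2).symm

open MeasureTheory

/-- A lift to `ℝ` of the boundary value of the disc automorphism
`ζ ↦ (ζ + t) / (1 + t ζ)`. -/
def moebiusAngle (t s : ℝ) : ℝ := s - 2 * arg (1 + t * exp (s * I))

/-- The Poisson integral of `φ` at the point `t z` of the disc. -/
def poissonFlow (t : ℝ) (φ : Circle → ℝ) (z : Circle) : ℝ :=
  (2 * Real.pi)⁻¹ * ∫ s in (0)..(2 * Real.pi), φ (z * Circle.exp (moebiusAngle t s))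

lemma measurable_moebiusAngle (t : ℝ) : Measurable (moebiusAngle t) := by
  unfold moebiusAngle
  have : Measurable fun s : ℝ => 1 + (t : ℂ) * exp (s * I) :=
    (by fun_prop : Continuous fun s : ℝ => 1 + (t : ℂ) * exp (s * I)).measurable
  exact measurable_id.sub ((measurable_arg.comp this).const_mul 2)

lemma measurable_comp_moebius {φ : Circle → ℝ} (hφ : Continuous φ) (t : ℝ) (z : Circle) :
    Measurable fun s => φ (z * Circle.exp (moebiusAngle t s)) :=
  (by fun_prop : Continuous fun u : ℝ => φ (z * Circle.exp u)).measurable.comp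
    (measurable_moebiusAngle t)

lemma intervalIntegrable_comp_moebius {φ : Circle → ℝ} (hφ : Continuous φ) (t : ℝ) (z : Circle) :
    IntervalIntegrable (fun s => φ (z * Circle.exp (moebiusAngle t s))) volume
      0 (2 * Real.pi) := by
  obtain ⟨C, hC⟩ := (isCompact_range hφ).isBounded.exists_norm_le
  refine (intervalIntegrable_const (c := C)).mono_fun
    (measurable_comp_moebius hφ t z).aestronglyMeasurable (ae_of_all _ fun s => ?_)
  exact (hC _ (mem_range_self _)).trans (le_abs_self C)

lemma poissonFlow_add {φ ψ : Circle → ℝ} (hφ : Continuous φ) (hψ : Continuous ψ) (t : ℝ)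
    (z : Circle) :
    poissonFlow t (fun w => φ w + ψ w) z = poissonFlow t φ z + poissonFlow t ψ z := by
  unfold poissonFlow
  rw [intervalIntegral.integral_add (intervalIntegrable_comp_moebius hφ t z)
    (intervalIntegrable_comp_moebius hψ t z), mul_add]

lemma poissonFlow_neg (φ : Circle → ℝ) (t : ℝ) (z : Circle) :
    poissonFlow t (fun w => -φ w) z = -poissonFlow t φ z := by
  simp [poissonFlow]

lemma poissonFlow_const (c t : ℝ) (z : Circle) : poissonFlow t (fun _ => c) z = c := by
  simp [poissonFlow]
  field_simp

lemma poissonFlow_multiset_sum {ι : Type*} (S : Multiset ι) {φ : ι → Circle → ℝ}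
    (hφ : ∀ i ∈ S, Continuous (φ i)) (t : ℝ) (z : Circle) :
    poissonFlow t (fun w => (S.map fun i => φ i w).sum) z =
      (S.map fun i => poissonFlow t (φ i) z).sum := by
  induction S using Multiset.induction_on with
  | empty => simpa using poissonFlow_const 0 t z
  | cons i S ih =>
    simp only [Multiset.map_cons, Multiset.sum_cons]
    rw [poissonFlow_add (hφ i (Multiset.mem_cons_self i S))
      (continuous_multiset_sum S fun j hj => hφ j (Multiset.mem_cons_of_mem hj)),
      ih fun j hj => hφ j (Multiset.mem_cons_of_mem hj)]

lemma one_add_mul_exp_mem_slitPlane {t s : ℝ} (ht : t ∈ Icc (0 : ℝ) 1)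
    (hs : s ∈ Ioc 0 (2 * Real.pi)) (hsπ : s ≠ Real.pi) :
    1 + (t : ℂ) * exp (s * I) ∈ slitPlane := by
  left
  have hcos : -1 < Real.cos s := by
    refine lt_of_le_of_ne (Real.neg_one_le_cos s) fun h => hsπ ?_
    obtain ⟨k, hk⟩ := Real.cos_eq_neg_one_iff.1 h.symm
    have hπ := Real.pi_pos
    have h1 : (k : ℝ) < 1 := by nlinarith [hs.2]
    have h2 : (-1 : ℝ) < k := by nlinarith [hs.1]
    have h3 : k = 0 := by
      have : k < 1 := by exact_mod_cast h1
      have : -1 < k := by exact_mod_cast h2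
      omega
    rw [← hk, h3]; simp
  have : (1 + (t : ℂ) * exp (s * I)).re = 1 + t * Real.cos s := by
    simp [exp_ofReal_mul_I_re]
  rw [this]
  have h0 := ht.1
  have h1 := ht.2
  rcases h0.eq_or_lt with rfl | h0
  · simp
  · nlinarith

lemma exp_two_mul_arg {w : ℂ} (hw : w ≠ 0) :
    exp (2 * arg w * I) = w / (starRingEnd ℂ) w := by
  have hc : (starRingEnd ℂ) w ≠ 0 := by simpa using hw
  have h := norm_mul_exp_arg_mul_I w
  have hn : (‖w‖ : ℂ) ≠ 0 := by simpa using hw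
  have h2 : (starRingEnd ℂ) w * w = ‖w‖ ^ 2 := conj_mul' w
  have hE : exp (2 * arg w * I) = exp (arg w * I) ^ 2 := by
    rw [← exp_nat_mul]; congr 1; push_cast; ring
  rw [eq_div_iff hc, hE]
  refine mul_left_cancel₀ (pow_ne_zero 2 hn) ?_
  linear_combination (starRingEnd ℂ) w * (‖w‖ * exp (arg w * I) + w) * h + w * h2

lemma coe_exp_moebiusAngle {t s : ℝ} (h : 1 + (t : ℂ) * exp (s * I) ≠ 0) :
    (Circle.exp (moebiusAngle t s) : ℂ) = (exp (s * I) + t) / (1 + t * exp (s * I)) := by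
  have h1 : exp (s * I) ≠ 0 := exp_ne_zero _
  have h2 : (starRingEnd ℂ) (exp (s * I)) = (exp (s * I))⁻¹ := by
    rw [← exp_conj, ← exp_neg]; simp
  rw [moebiusAngle, Circle.coe_exp]
  push_cast
  rw [sub_mul, exp_sub, exp_two_mul_arg h, map_add, map_mul, map_one, conj_ofReal, h2]
  field_simp

lemma continuous_poissonFlow {X : Type*} [TopologicalSpace X] [FirstCountableTopology X]
    {t : X → ℝ} (ht : Continuous t) (ht01 : ∀ x, t x ∈ Icc (0 : ℝ) 1) {φ : X → C(Circle, ℝ)}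
    (hφ : Continuous φ) {z : X → Circle} (hz : Continuous z) :
    Continuous fun x => poissonFlow (t x) (φ x) (z x) := by
  unfold poissonFlow
  refine continuous_const.mul (continuous_iff_continuousAt.2 fun x₀ => ?_)
  refine intervalIntegral.continuousAt_of_dominated_interval (bound := fun _ => ‖φ x₀‖ + 1)
    (Eventually.of_forall fun x =>
      (measurable_comp_moebius (φ x).continuous _ _).aestronglyMeasurable) ?_
    intervalIntegrable_const ?_
  · have : ∀ᶠ x in 𝓝 x₀, ‖φ x‖ < ‖φ x₀‖ + 1 :=
      hφ.norm.continuousAt.eventually_lt continuousAt_const (by simp)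
    filter_upwards [this] with x hx
    exact ae_of_all _ fun s _ => ((φ x).norm_coe_le_norm _).trans hx.le
  · have hne : ∀ᵐ s : ℝ, s ≠ Real.pi := by simp [ae_iff]
    filter_upwards [hne] with s hs hmem
    rw [uIoc_of_le Real.two_pi_pos.le] at hmem
    have hang : ContinuousAt (fun x => moebiusAngle (t x) s) x₀ := by
      unfold moebiusAngle
      refine continuousAt_const.sub (continuousAt_const.mul ?_)
      refine ContinuousAt.comp (f := fun x => 1 + (t x : ℂ) * exp (s * I))
        (continuousAt_arg (one_add_mul_exp_mem_slitPlane (ht01 x₀) hmem hs)) ?_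
      fun_prop
    have : ContinuousAt (fun x => z x * Circle.exp (moebiusAngle (t x) s)) x₀ :=
      hz.continuousAt.mul (Circle.exp.continuous.continuousAt.comp hang)
    exact (hφ.continuousAt).eval this

lemma poissonFlow_one (φ : Circle → ℝ) (z : Circle) : poissonFlow 1 φ z = φ z := by
  unfold poissonFlow
  have : ∫ s in (0)..(2 * Real.pi), φ (z * Circle.exp (moebiusAngle 1 s)) =
      ∫ s in (0)..(2 * Real.pi), φ z := by
    refine intervalIntegral.integral_congr_ae ?_
    have hne : ∀ᵐ s : ℝ, s ≠ Real.pi := by simp [ae_iff]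
    filter_upwards [hne] with s hs hmem
    rw [uIoc_of_le Real.two_pi_pos.le] at hmem
    have h := slitPlane_ne_zero
      (one_add_mul_exp_mem_slitPlane (t := 1) ⟨zero_le_one, le_rfl⟩ hmem hs)
    have : Circle.exp (moebiusAngle 1 s) = 1 := by
      ext
      rw [coe_exp_moebiusAngle h, Circle.coe_one, div_eq_one_iff_eq h]
      push_cast
      ring
    rw [this, mul_one]
  rw [this]
  simp
  field_simp

lemma poissonFlow_zero (φ : Circle → ℝ) (z : Circle) : poissonFlow 0 φ z = poissonFlow 0 φ 1 := by
  obtain ⟨α, rfl⟩ := Circle.exp_surjective z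
  simp only [poissonFlow, moebiusAngle, ofReal_zero, zero_mul, add_zero, arg_one, mul_zero,
    sub_zero, one_mul, ← Circle.exp_add]
  congr 1
  have hper : Function.Periodic (fun s => φ (Circle.exp s)) (2 * Real.pi) := fun s => by
    simp only [Circle.exp_add_two_pi]
  have h := hper.intervalIntegral_add_eq α 0
  rw [intervalIntegral.integral_comp_add_left (fun s => φ (Circle.exp s)) α]
  simpa using h

/-- A logarithm of the Blaschke factor with zero `c`, divided by `z` and a constant. -/
def blaschkePhase (c : ℂ) (z : Circle) : ℝ := -2 * arg (1 - (starRingEnd ℂ) c * z)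

lemma one_sub_mem_slitPlane {w : ℂ} (h : ‖w‖ < 1) : 1 - w ∈ slitPlane := by
  left
  have := (re_le_norm w).trans_lt h
  simpa using this

lemma norm_conj_mul_lt {c : ℂ} (hc : ‖c‖ < 1) (z : Circle) : ‖(starRingEnd ℂ) c * z‖ < 1 := by
  rwa [norm_mul, Circle.norm_coe, mul_one, RCLike.norm_conj]

lemma continuous_blaschkePhase {c : ℂ} (hc : ‖c‖ < 1) : Continuous (blaschkePhase c) := by
  refine continuous_const.mul (continuous_iff_continuousAt.2 fun z => ?_)
  refine ContinuousAt.comp (f := fun z : Circle => 1 - (starRingEnd ℂ) c * z)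
    (continuousAt_arg (one_sub_mem_slitPlane (norm_conj_mul_lt hc z))) ?_
  have := isInducing_coe_circle.continuous
  fun_prop

lemma one_add_mul_ne_zero {t : ℝ} (ht : t ∈ Ico (0 : ℝ) 1) {ζ : ℂ} (hζ : ‖ζ‖ ≤ 1) :
    1 + (t : ℂ) * ζ ≠ 0 := by
  intro h
  have h1 : (t : ℂ) * ζ = -1 := by linear_combination h
  have h2 := congrArg norm h1
  rw [norm_mul, norm_neg, norm_one, norm_real, Real.norm_of_nonneg ht.1] at h2
  nlinarith [ht.1, ht.2, norm_nonneg ζ]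

lemma norm_moebius_le {t : ℝ} (ht : t ∈ Ico (0 : ℝ) 1) {ζ : ℂ} (hζ : ‖ζ‖ ≤ 1) :
    ‖(ζ + t) / (1 + t * ζ)‖ ≤ 1 := by
  rw [norm_div, div_le_one (norm_pos_iff.2 (one_add_mul_ne_zero ht hζ))]
  rw [← sq_le_sq₀ (norm_nonneg _) (norm_nonneg _), Complex.sq_norm, Complex.sq_norm]
  have h1 : normSq ζ ≤ 1 := by
    rw [← Complex.sq_norm]; exact pow_le_one₀ (norm_nonneg _) hζ
  have h2 : t ^ 2 ≤ 1 := pow_le_one₀ ht.1 ht.2.le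
  simp only [normSq_apply, add_re, add_im, mul_re, mul_im, ofReal_re, ofReal_im, one_re,
    one_im] at h1 ⊢
  nlinarith [mul_nonneg (sub_nonneg.2 h1) (sub_nonneg.2 h2)]

lemma poissonFlow_blaschkePhase {t : ℝ} (ht : t ∈ Icc (0 : ℝ) 1) {c : ℂ} (hc : ‖c‖ < 1)
    (z : Circle) : poissonFlow t (blaschkePhase c) z = blaschkePhase (t * c) z := by
  rcases ht.2.eq_or_lt with rfl | ht1
  · simp [poissonFlow_one]
  have ht' : t ∈ Ico (0 : ℝ) 1 := ⟨ht.1, ht1⟩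
  let F : ℂ → ℂ := fun ζ => log (1 - (starRingEnd ℂ) c * (z * ((ζ + t) / (1 + t * ζ))))
  have hslit {ζ : ℂ} (hζ : ‖ζ‖ ≤ 1) :
      1 - (starRingEnd ℂ) c * (z * ((ζ + t) / (1 + t * ζ))) ∈ slitPlane := by
    refine one_sub_mem_slitPlane ?_
    rw [← mul_assoc, norm_mul]
    have := norm_moebius_le ht' hζ
    have := norm_conj_mul_lt hc z
    nlinarith [norm_nonneg ((starRingEnd ℂ) c * z)]
  have hF : DifferentiableOn ℂ F (Metric.closedBall 0 1) := by
    intro ζ hζ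
    have hζ' : ‖ζ‖ ≤ 1 := by simpa using hζ
    refine DifferentiableAt.differentiableWithinAt (DifferentiableAt.clog ?_ (hslit hζ'))
    refine (differentiableAt_const _).sub ((differentiableAt_const _).mul
      ((differentiableAt_const _).mul (DifferentiableAt.div ?_ ?_ (one_add_mul_ne_zero ht' hζ'))))
      <;> fun_prop
  have hF' : DiffContOnCl ℂ F (Metric.ball 0 |1|) := by
    rw [abs_one]
    refine ⟨hF.mono Metric.ball_subset_closedBall, ?_⟩
    rw [closure_ball _ one_ne_zero]
    exact hF.continuousOn
  have key := hF'.circleAverage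
  have hcirc (s : ℝ) : ‖circleMap 0 1 s‖ ≤ 1 := by simp
  have hint : IntervalIntegrable (fun s => F (circleMap 0 1 s)) volume 0 (2 * Real.pi) := by
    refine ContinuousOn.intervalIntegrable (Continuous.continuousOn ?_)
    refine hF.continuousOn.comp_continuous (continuous_circleMap 0 1) fun s => by simp
  have key2 := congrArg imCLM key
  rw [Real.circleAverage_def, _root_.map_smul, ← imCLM.intervalIntegral_comp_comm hint] at key2
  have hval (s : ℝ) : blaschkePhase c (z * Circle.exp (moebiusAngle t s)) =
      -2 * imCLM (F (circleMap 0 1 s)) := by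
    have h1 : circleMap 0 1 s = exp (s * I) := by simp [circleMap]
    have h2 : 1 + (t : ℂ) * exp (s * I) ≠ 0 := by
      rw [← h1]; exact one_add_mul_ne_zero ht' (hcirc s)
    rw [blaschkePhase, Circle.coe_mul, coe_exp_moebiusAngle h2, h1]
    simp only [F, imCLM_apply, log_im]
  unfold poissonFlow
  simp only [hval]
  rw [intervalIntegral.integral_const_mul]
  simp only [smul_eq_mul] at key2
  rw [mul_left_comm, key2]
  simp only [F, imCLM_apply, log_im, blaschkePhase]
  congr 3
  simp
  ring

/-- The self-map of the circle corresponding to a loop in `ℝP¹`. -/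
def circleMapOfLoop (f : OmegaRP 1) : C(Circle, Circle) :=
  (homeoRP : C(RP 1, Circle)).comp (f.1.comp (homeoOnePoint.symm : C(Circle, OnePoint ℝ)))

lemma circleMapOfLoop_apply (f : OmegaRP 1) (z : Circle) :
    circleMapOfLoop f z = homeoRP (f.1 (homeoOnePoint.symm z)) := rfl

lemma circleMapOfLoop_cayley (f : OmegaRP 1) (x : OnePoint ℝ) :
    circleMapOfLoop f (cayley x) = homeoRP (f.1 x) := by
  rw [circleMapOfLoop_apply, ← homeoOnePoint_apply, Homeomorph.symm_apply_apply]

lemma circleMapOfLoop_one (f : OmegaRP 1) : circleMapOfLoop f 1 = 1 := by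
  rw [← cayley_infty, circleMapOfLoop_cayley, f.2, homeoRP_basept, cayley_infty]

/-- The Blaschke factor with zero `c`, normalized to take the value `1` at `1`. -/
def blaschke (c : ℂ) (z : Circle) : Circle :=
  z * Circle.exp (blaschkePhase c z - blaschkePhase c 1)

lemma blaschke_one (c : ℂ) : blaschke c 1 = 1 := by simp [blaschke]

lemma exp_blaschkePhase {c : ℂ} (hc : ‖c‖ < 1) (z : Circle) :
    (Circle.exp (blaschkePhase c z) : ℂ) = (1 - c * (z : ℂ)⁻¹) / (1 - (starRingEnd ℂ) c * z) := by
  have h := slitPlane_ne_zero (one_sub_mem_slitPlane (norm_conj_mul_lt hc z))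
  have : (blaschkePhase c z : ℂ) * I = -(2 * arg (1 - (starRingEnd ℂ) c * z) * I) := by
    rw [blaschkePhase]; push_cast; ring
  rw [Circle.coe_exp, this, exp_neg, exp_two_mul_arg h, inv_div, map_sub, map_mul, map_one,
    conj_conj, ← Circle.coe_inv_eq_conj, Circle.coe_inv]

lemma coe_blaschke {c : ℂ} (hc : ‖c‖ < 1) (z : Circle) :
    (blaschke c z : ℂ) =
      (z - c) / (1 - (starRingEnd ℂ) c * z) * ((1 - (starRingEnd ℂ) c) / (1 - c)) := by
  have hz : (z : ℂ) ≠ 0 := Circle.coe_ne_zero z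
  rw [blaschke, Circle.exp_sub, Circle.coe_mul, Circle.coe_div, exp_blaschkePhase hc,
    exp_blaschkePhase hc]
  simp only [Circle.coe_one, inv_one, mul_one]
  have h : (z : ℂ) * (1 - c * (z : ℂ)⁻¹) = z - c := by field_simp
  rw [← h, div_div_eq_mul_div]
  ring

/-- The Cayley transform, from the upper half-plane to the unit disc. -/
def toDisc (w : ℂ) : ℂ := (w - I) / (w + I)

/-- The inverse of the Cayley transform. -/
def ofDisc (c : ℂ) : ℂ := I * (1 + c) / (1 - c)

lemma add_I_ne_zero {w : ℂ} (hw : 0 < w.im) : w + I ≠ 0 := by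
  intro h
  have := congrArg im h
  simp at this
  linarith

lemma one_sub_ne_zero_of_norm_lt {c : ℂ} (hc : ‖c‖ < 1) : 1 - c ≠ 0 :=
  slitPlane_ne_zero (one_sub_mem_slitPlane hc)

lemma norm_toDisc_lt {w : ℂ} (hw : 0 < w.im) : ‖toDisc w‖ < 1 := by
  rw [toDisc, norm_div, div_lt_one (norm_pos_iff.2 (add_I_ne_zero hw)),
    ← sq_lt_sq₀ (norm_nonneg _) (norm_nonneg _), Complex.sq_norm, Complex.sq_norm]
  simp only [normSq_apply, add_re, add_im, sub_re, sub_im, I_re, I_im]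
  nlinarith

lemma im_ofDisc_pos {c : ℂ} (hc : ‖c‖ < 1) : 0 < (ofDisc c).im := by
  have h := normSq_pos.2 (one_sub_ne_zero_of_norm_lt hc)
  have h1 : normSq c < 1 := by
    rw [← Complex.sq_norm]; exact pow_lt_one₀ (norm_nonneg _) hc two_ne_zero
  have h2 : (ofDisc c).im = (1 - normSq c) / normSq (1 - c) := by
    rw [ofDisc, div_im]
    simp [normSq_apply]
    field_simp
    ring
  rw [h2]
  exact div_pos (by linarith) h

lemma toDisc_ofDisc {c : ℂ} (hc : ‖c‖ < 1) : toDisc (ofDisc c) = c := by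
  have h := one_sub_ne_zero_of_norm_lt hc
  have h1 := add_I_ne_zero (im_ofDisc_pos hc)
  have h2 : (1 - c) * ofDisc c = I * (1 + c) := by rw [ofDisc]; field_simp
  rw [toDisc, div_eq_iff h1]
  linear_combination h2

lemma ofDisc_toDisc {w : ℂ} (hw : 0 < w.im) : ofDisc (toDisc w) = w := by
  have h := one_sub_ne_zero_of_norm_lt (norm_toDisc_lt hw)
  have h1 := add_I_ne_zero hw
  have h2 : toDisc w * (w + I) = w - I := by rw [toDisc]; field_simp
  rw [ofDisc, div_eq_iff h]
  linear_combination h2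

lemma coe_blaschke_cayley {w : ℂ} (hw : 0 < w.im) (x : ℝ) :
    (blaschke (toDisc w) (cayley x) : ℂ) = (x - w) / (x - (starRingEnd ℂ) w) := by
  have h1 := add_I_ne_zero hw
  have h2 : (starRingEnd ℂ) w - I ≠ 0 := by
    have := (map_ne_zero (starRingEnd ℂ)).2 h1
    rwa [map_add, conj_I, ← sub_eq_add_neg] at this
  have h3 : (x : ℂ) + I ≠ 0 := ofReal_add_I_ne_zero x
  have h4 : (x : ℂ) - (starRingEnd ℂ) w ≠ 0 := by
    intro h
    have := congrArg im h
    simp at this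
    linarith
  have hI := I_ne_zero
  have e1 : (cayley x : ℂ) - toDisc w = 2 * I * (x - w) / ((x + I) * (w + I)) := by
    rw [coe_cayley, toDisc]; field_simp; ring
  have e2 : 1 - (starRingEnd ℂ) (toDisc w) * cayley x =
      -2 * I * (x - (starRingEnd ℂ) w) / (((starRingEnd ℂ) w - I) * (x + I)) := by
    rw [coe_cayley, toDisc, map_div₀, map_sub, map_add, conj_I, sub_neg_eq_add,
      ← sub_eq_add_neg]
    field_simp
    ring
  have e3 : 1 - (starRingEnd ℂ) (toDisc w) = -2 * I / ((starRingEnd ℂ) w - I) := by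
    rw [toDisc, map_div₀, map_sub, map_add, conj_I, sub_neg_eq_add, ← sub_eq_add_neg]
    field_simp
    ring
  have e4 : 1 - toDisc w = 2 * I / (w + I) := by
    rw [toDisc]; field_simp; ring
  rw [coe_blaschke (norm_toDisc_lt hw), e1, e2, e3, e4]
  field_simp

/-- The polynomials attached to loops by `RRat`, with the two real polynomials combined into
one complex polynomial. -/
lemma mem_RRat_iff_exists_polynomial {n : ℕ} {f : OmegaRP 1} :
    f ∈ RRat n 1 ↔ ∃ W : Polynomial ℂ, W.Monic ∧ W.natDegree = n ∧
      (∀ z, W.eval z = 0 → W.eval ((starRingEnd ℂ) z) ≠ 0) ∧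
      ∀ x : ℝ, (homeoRP (f.1 x) : ℂ) = W.eval (x : ℂ) / (starRingEnd ℂ) (W.eval (x : ℂ)) := by
  have hI := one_add_I_ne_zero
  constructor
  · rintro ⟨p, hm, hd, hr, hf⟩
    let Q : Polynomial ℂ := (p 0).map (algebraMap ℝ ℂ) + Polynomial.C I * (p 1).map (algebraMap ℝ ℂ)
    have hev (z : ℂ) : (Polynomial.C (1 + I)⁻¹ * Q).eval z =
        (Polynomial.aeval z (p 0) + I * Polynomial.aeval z (p 1)) / (1 + I) := by
      simp [Q, Polynomial.aeval_def, Polynomial.eval_map]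
      ring
    have hle (i : Fin 2) : ((p i).map (algebraMap ℝ ℂ)).natDegree ≤ n :=
      Polynomial.natDegree_map_le.trans (hd i).le
    have hle' : (Polynomial.C (1 + I)⁻¹ * Q).natDegree ≤ n :=
      (Polynomial.natDegree_C_mul_le _ _).trans
        ((Polynomial.natDegree_add_le_of_degree_le (hle 0)
          ((Polynomial.natDegree_C_mul_le _ _).trans (hle 1))))
    have hco (i : Fin 2) : (p i).coeff n = 1 := by
      rw [← hd i]; exact (hm i).coeff_natDegree
    have hco' : (Polynomial.C (1 + I)⁻¹ * Q).coeff n = 1 := by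
      simp [Q, hco]
      field_simp
    refine ⟨Polynomial.C (1 + I)⁻¹ * Q, Polynomial.monic_of_natDegree_le_of_coeff_eq_one n hle' hco',
      ?_, fun z h1 h2 => ?_, fun x => ?_⟩
    · refine le_antisymm hle' (Polynomial.le_natDegree_of_ne_zero ?_)
      rw [hco']; exact one_ne_zero
    · rw [hev, div_eq_zero_iff, or_iff_left hI] at h1 h2
      have h3 := congrArg (starRingEnd ℂ) h2
      simp only [Polynomial.aeval_conj, map_add, map_mul, conj_conj, conj_I, map_zero] at h3
      obtain ⟨i, hi⟩ := hr z
      fin_cases i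
      · exact hi (by simp only [Fin.zero_eta]; linear_combination (h1 + h3) / 2)
      · exact hi (by
          simp only [Fin.mk_one]
          linear_combination (-I / 2) * (h1 - h3) + Polynomial.aeval z (p 1) * I_mul_I)
    · obtain ⟨hx, h⟩ := hf x
      have hx (q : Polynomial ℝ) : Polynomial.aeval (x : ℂ) q = ((q.eval x : ℝ) : ℂ) :=
        Polynomial.aeval_algebraMap_apply_eq_algebraMap_eval x q
      rw [h, coe_homeoRP_mk, hev, hx, hx]
      simp only [map_div₀, map_add, map_mul, conj_I, conj_ofReal, map_one]
      congr 2 <;> ring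
  · rintro ⟨W, hm, hd, hr, hf⟩
    let a : Fin 2 → ℕ → ℝ := ![fun k => ((1 + I) * W.coeff k).re, fun k => ((1 + I) * W.coeff k).im]
    let p : Fin 2 → Polynomial ℝ := fun i =>
      ∑ k ∈ Finset.range (n + 1), Polynomial.monomial k (a i k)
    have hco (i : Fin 2) (k : ℕ) : (p i).coeff k = if k ≤ n then a i k else 0 := by
      simp [p, Polynomial.coeff_monomial]
    have han (i : Fin 2) : a i n = 1 := by
      have : W.coeff n = 1 := by rw [← hd]; exact hm.coeff_natDegree
      fin_cases i <;> simp [a, this]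
    have hle (i : Fin 2) : (p i).natDegree ≤ n := by
      refine Polynomial.natDegree_le_iff_coeff_eq_zero.2 fun k hk => ?_
      rw [hco, if_neg (not_le.2 hk)]
    have hc1 (i : Fin 2) : (p i).coeff n = 1 := by rw [hco, if_pos le_rfl, han]
    have hsum : (p 0).map (algebraMap ℝ ℂ) + Polynomial.C I * (p 1).map (algebraMap ℝ ℂ) =
        Polynomial.C (1 + I) * W := by
      ext k
      rw [Polynomial.coeff_add, Polynomial.coeff_C_mul, Polynomial.coeff_C_mul,
        Polynomial.coeff_map, Polynomial.coeff_map, hco, hco]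
      split_ifs with hk
      · have := re_add_im ((1 + I) * W.coeff k)
        rw [mul_comm] at this
        simpa [a, mul_comm] using this
      · rw [Polynomial.coeff_eq_zero_of_natDegree_lt (hd ▸ not_le.1 hk)]
        simp
    have hev (z : ℂ) : Polynomial.aeval z (p 0) + I * Polynomial.aeval z (p 1) =
        (1 + I) * W.eval z := by
      have := congrArg (Polynomial.eval z) hsum
      simpa only [Polynomial.eval_add, Polynomial.eval_mul, Polynomial.eval_C,
        Polynomial.eval_map_algebraMap] using this
    have hcom (z : ℂ) : ∃ i, Polynomial.aeval z (p i) ≠ 0 := by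
      by_contra! h
      have hW (y : ℂ) (hy : ∀ i, Polynomial.aeval y (p i) = 0) : W.eval y = 0 := by
        have := hev y
        rw [hy, hy, mul_zero, add_zero] at this
        exact (mul_eq_zero.1 this.symm).resolve_left hI
      exact hr z (hW z h) (hW _ fun i => by rw [Polynomial.aeval_conj, h, map_zero])
    have hreal (x : ℝ) (q : Polynomial ℝ) : Polynomial.aeval (x : ℂ) q = ((q.eval x : ℝ) : ℂ) :=
      Polynomial.aeval_algebraMap_apply_eq_algebraMap_eval x q
    refine ⟨p, fun i => Polynomial.monic_of_natDegree_le_of_coeff_eq_one n (hle i) (hc1 i),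
      fun i => le_antisymm (hle i) (Polynomial.le_natDegree_of_ne_zero ?_), hcom, fun x => ?_⟩
    · rw [hc1]; exact one_ne_zero
    · have hx : (fun i => (p i).eval x) ≠ 0 := by
        obtain ⟨i, hi⟩ := hcom x
        rw [hreal] at hi
        exact fun h => hi (by rw [congrFun h i]; simp)
      refine ⟨hx, homeoRP.injective (Circle.ext ?_)⟩
      have h1 := hev x
      rw [hreal, hreal] at h1
      have h2 := congrArg (starRingEnd ℂ) h1
      simp only [map_add, map_mul, conj_I, conj_ofReal, map_one] at h2
      have h3 : W.eval (x : ℂ) = ((p 0).eval x + (p 1).eval x * I) / (1 + I) := by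
        rw [eq_div_iff hI]; linear_combination -h1
      have h4 : (starRingEnd ℂ) (W.eval (x : ℂ)) =
          ((p 0).eval x - (p 1).eval x * I) / (1 - I) := by
        rw [eq_div_iff one_sub_I_ne_zero]; linear_combination -h2
      rw [hf, coe_homeoRP_mk, h4, h3]

lemma prod_map_blaschke_cayley {S : Multiset ℂ} (hS : ∀ w ∈ S, 0 < w.im) (x : ℝ) :
    (((S.map toDisc).map fun c => blaschke c (cayley x)).prod : ℂ) =
      (S.map fun w => (x - w) / (x - (starRingEnd ℂ) w)).prod := by
  rw [Multiset.map_map]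
  refine (map_multiset_prod Circle.coeHom _).trans ?_
  rw [Multiset.map_map]
  exact congrArg Multiset.prod
    (Multiset.map_congr rfl fun w hw => coe_blaschke_cayley (hS w hw) x)

lemma eval_div_conj_eval (A B : Multiset ℂ) (x : ℝ) {W : Polynomial ℂ}
    (hW : W = ((A + B.map (starRingEnd ℂ)).map fun w => Polynomial.X - Polynomial.C w).prod) :
    W.eval (x : ℂ) / (starRingEnd ℂ) (W.eval (x : ℂ)) =
      (A.map fun w => (x - w) / (x - (starRingEnd ℂ) w)).prod /
        (B.map fun w => (x - w) / (x - (starRingEnd ℂ) w)).prod := by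
  subst hW
  simp only [Polynomial.eval_multiset_prod, Multiset.map_add, Multiset.prod_add, Multiset.map_map,
    Polynomial.eval_mul, map_mul, map_multiset_prod, Function.comp_def, Polynomial.eval_sub,
    Polynomial.eval_X, Polynomial.eval_C, map_sub, conj_ofReal, conj_conj, Multiset.prod_map_div]
  rw [div_div_div_eq]

lemma conj_ne_self_of_mem_roots {W : Polynomial ℂ}
    (hr : ∀ z, W.eval z = 0 → W.eval ((starRingEnd ℂ) z) ≠ 0) {w : ℂ} (hw : W.eval w = 0) :
    w.im ≠ 0 := fun h => hr w hw (by rwa [conj_eq_iff_im.2 h])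

lemma mem_RRat_iff_exists_multiset {n : ℕ} {f : OmegaRP 1} :
    f ∈ RRat n 1 ↔ ∃ U L : Multiset ℂ, (∀ c ∈ U, ‖c‖ < 1) ∧ (∀ c ∈ L, ‖c‖ < 1) ∧
      (∀ c ∈ U, c ∉ L) ∧ U.card + L.card = n ∧
      ∀ z, circleMapOfLoop f z =
        (U.map fun c => blaschke c z).prod / (L.map fun c => blaschke c z).prod := by
  rw [mem_RRat_iff_exists_polynomial]
  constructor
  · rintro ⟨W, hm, hd, hr, hf⟩
    let A := W.roots.filter fun w => 0 < w.im
    let B := (W.roots.filter fun w => ¬ 0 < w.im).map (starRingEnd ℂ)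
    have hroot {w : ℂ} (hw : w ∈ W.roots) : W.eval w = 0 := (Polynomial.mem_roots'.1 hw).2
    have hA : ∀ w ∈ A, 0 < w.im := fun w hw => (Multiset.mem_filter.1 hw).2
    have hB' : ∀ w ∈ B, 0 < w.im ∧ (starRingEnd ℂ) w ∈ W.roots := by
      intro w hw
      obtain ⟨v, hv, rfl⟩ := Multiset.mem_map.1 hw
      obtain ⟨hv1, hv2⟩ := Multiset.mem_filter.1 hv
      refine ⟨?_, by rwa [conj_conj]⟩
      rw [conj_im, neg_pos]
      exact lt_of_le_of_ne (not_lt.1 hv2) (conj_ne_self_of_mem_roots hr (hroot hv1))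
    have hB : ∀ w ∈ B, 0 < w.im := fun w hw => (hB' w hw).1
    have hsplit := IsAlgClosed.splits W
    refine ⟨A.map toDisc, B.map toDisc, ?_, ?_, ?_, ?_, fun z => ?_⟩
    · intro c hc
      obtain ⟨w, hw, rfl⟩ := Multiset.mem_map.1 hc
      exact norm_toDisc_lt (hA w hw)
    · intro c hc
      obtain ⟨w, hw, rfl⟩ := Multiset.mem_map.1 hc
      exact norm_toDisc_lt (hB w hw)
    · intro c hc hc'
      obtain ⟨w, hw, rfl⟩ := Multiset.mem_map.1 hc
      obtain ⟨v, hv, hvw⟩ := Multiset.mem_map.1 hc'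
      have : v = w := by
        rw [← ofDisc_toDisc (hB v hv), hvw, ofDisc_toDisc (hA w hw)]
      subst this
      exact hr v (hroot (Multiset.mem_filter.1 hw).1) (hroot (hB' v hv).2)
    · rw [Multiset.card_map, Multiset.card_map, Multiset.card_map, ← Multiset.card_add,
        Multiset.filter_add_not, ← hd, hsplit.natDegree_eq_card_roots]
    · obtain ⟨x, rfl⟩ := cayley_bijective.2 z
      induction x using OnePoint.rec with
      | infty => simp [cayley_infty, circleMapOfLoop_one, blaschke_one]
      | coe x =>
        refine Circle.ext ?_
        rw [circleMapOfLoop_cayley, Circle.coe_div, prod_map_blaschke_cayley hA,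
          prod_map_blaschke_cayley hB, hf]
        refine eval_div_conj_eval A B x ?_
        have hBmap : B.map (starRingEnd ℂ) = W.roots.filter fun w => ¬ 0 < w.im := by
          simp [B, Multiset.map_map]
        rw [hBmap, Multiset.filter_add_not]
        exact hsplit.eq_prod_roots_of_monic hm
  · rintro ⟨U, L, hU, hL, hdisj, hcard, hf⟩
    let R : Multiset ℂ := U.map ofDisc + L.map fun c => (starRingEnd ℂ) (ofDisc c)
    have hW : (R.map fun w => Polynomial.X - Polynomial.C w).prod.roots = R :=
      Polynomial.roots_multiset_prod_X_sub_C R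
    have hm : (R.map fun w => Polynomial.X - Polynomial.C w).prod.Monic :=
      Polynomial.monic_multisetProd_X_sub_C R
    have hmem {z : ℂ} (hz : (R.map fun w => Polynomial.X - Polynomial.C w).prod.eval z = 0) :
        z ∈ R := by rw [← hW]; exact (Polynomial.mem_roots hm.ne_zero).2 hz
    have hcases {z : ℂ} (hz : z ∈ R) :
        (0 < z.im ∧ ∃ c ∈ U, ofDisc c = z) ∨
          (z.im < 0 ∧ ∃ c ∈ L, ofDisc c = (starRingEnd ℂ) z) := by
      rcases Multiset.mem_add.1 hz with h | h
      · obtain ⟨c, hc, rfl⟩ := Multiset.mem_map.1 h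
        exact Or.inl ⟨im_ofDisc_pos (hU c hc), c, hc, rfl⟩
      · obtain ⟨c, hc, rfl⟩ := Multiset.mem_map.1 h
        refine Or.inr ⟨?_, c, hc, (conj_conj _).symm⟩
        rw [conj_im, neg_lt_zero]
        exact im_ofDisc_pos (hL c hc)
    have hkey {c d : ℂ} (hc : c ∈ U) (hd : d ∈ L) (h : ofDisc c = ofDisc d) : False := by
      have : c = d := by rw [← toDisc_ofDisc (hU c hc), h, toDisc_ofDisc (hL d hd)]
      exact hdisj c hc (this ▸ hd)
    refine ⟨(R.map fun w => Polynomial.X - Polynomial.C w).prod, hm, ?_, fun z h1 h2 => ?_,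
      fun x => ?_⟩
    · rw [Polynomial.natDegree_multiset_prod_X_sub_C_eq_card]
      simpa [R] using hcard
    · rcases hcases (hmem h1) with ⟨h3, c, hc, hcz⟩ | ⟨h3, c, hc, hcz⟩ <;>
        rcases hcases (hmem h2) with ⟨h4, d, hd, hdz⟩ | ⟨h4, d, hd, hdz⟩ <;>
        rw [conj_im] at h4
      · linarith
      · exact hkey hc hd (by rw [hcz, hdz, conj_conj])
      · exact hkey hd hc (by rw [hcz, hdz])
      · linarith
    · rw [← circleMapOfLoop_cayley, hf, Circle.coe_div]
      have hUmap : U = (U.map ofDisc).map toDisc := by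
        rw [Multiset.map_map]
        exact (Multiset.map_id U).symm.trans
          (Multiset.map_congr rfl fun c hc => (toDisc_ofDisc (hU c hc)).symm)
      have hLmap : L = (L.map ofDisc).map toDisc := by
        rw [Multiset.map_map]
        exact (Multiset.map_id L).symm.trans
          (Multiset.map_congr rfl fun c hc => (toDisc_ofDisc (hL c hc)).symm)
      have hpos {S : Multiset ℂ} (hS : ∀ c ∈ S, ‖c‖ < 1) : ∀ w ∈ S.map ofDisc, 0 < w.im := by
        intro w hw
        obtain ⟨c, hc, rfl⟩ := Multiset.mem_map.1 hw
        exact im_ofDisc_pos (hS c hc)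
      rw [hUmap, hLmap, prod_map_blaschke_cayley (hpos hU), prod_map_blaschke_cayley (hpos hL)]
      refine (eval_div_conj_eval (U.map ofDisc) (L.map ofDisc) x ?_).symm
      rw [Multiset.map_map]
      rfl

open scoped unitInterval

/-- A deformation that pushes `R` into itself at positive times deforms every path component of
`closure R` to a point, provided its end depends only on a locally constant quantity. -/
lemma contractibleSpace_pathComponent_closure {X : Type*} [TopologicalSpace X] {R : Set X}
    {δ : X → ℤ} (hδ : Continuous δ) {H : I × X → X} (hH : Continuous H) (h1 : ∀ x, H (1, x) = x)
    (hR : ∀ t, 0 < t → ∀ x ∈ R, H (t, x) ∈ R) (h0 : ∀ x y, δ x = δ y → H (0, x) = H (0, y))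
    (x₀ : ↥(closure R)) : ContractibleSpace ↥(pathComponent x₀) := by
  have hcl (p : I × X) (hp : p.2 ∈ closure R) : H p ∈ closure R := by
    have hI : closure (Ioi (0 : I)) = univ := by
      rw [closure_Ioi' ⟨1, zero_lt_one⟩]
      exact eq_univ_of_forall fun t => unitInterval.nonneg'
    have hp' : p ∈ closure (Ioi (0 : I) ×ˢ R) := by
      rw [closure_prod_eq, hI]
      exact ⟨mem_univ _, hp⟩
    exact map_mem_closure hH hp' fun q hq => hR q.1 hq.1 q.2 hq.2
  let K : I × ↥(closure R) → ↥(closure R) := fun p => ⟨H (p.1, p.2), hcl _ p.2.2⟩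
  have hK : Continuous K := by
    refine Continuous.subtype_mk (hH.comp ?_) _
    fun_prop
  have hK1 (x : ↥(closure R)) : K (1, x) = x := Subtype.ext (h1 x)
  have hjoin (t : I) (x : ↥(closure R)) : Joined x (K (t, x)) := by
    have : PathConnectedSpace I := isPathConnected_iff_pathConnectedSpace.1
      ((convex_Icc (0 : ℝ) 1).isPathConnected ⟨0, unitInterval.zero_mem⟩)
    have := (PathConnectedSpace.joined (1 : I) t).map
      (hK.comp (by fun_prop : Continuous fun s : I => (s, x)))
    simpa only [Function.comp_apply, hK1] using this
  have hconst {x y : ↥(closure R)} (h : Joined x y) : δ x = δ y := by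
    have := PreconnectedSpace.constant inferInstance
      (hδ.comp (continuous_subtype_val.comp h.somePath.continuous)) (x := (0 : I)) (y := 1)
    simpa using this
  rw [contractible_iff_id_nullhomotopic]
  refine ⟨⟨K (0, x₀), hjoin 0 x₀⟩, ⟨⟨⟨fun p => ⟨K (unitInterval.symm p.1, p.2),
    p.2.2.trans (hjoin _ _)⟩, ?_⟩, fun x => ?_, fun x => ?_⟩⟩⟩
  · refine Continuous.subtype_mk (hK.comp ?_) _
    fun_prop
  · exact Subtype.ext (by simp [hK1])
  · refine Subtype.ext (Subtype.ext ?_)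
    simpa [K] using h0 _ _ (hconst x.2).symm

lemma prod_map_blaschke (U : Multiset ℂ) (z : Circle) :
    (U.map fun c => blaschke c z).prod = z ^ U.card *
      Circle.exp ((U.map fun c => blaschkePhase c z).sum -
        (U.map fun c => blaschkePhase c 1).sum) := by
  induction U using Multiset.induction_on with
  | empty => simp
  | cons c U ih =>
    simp only [Multiset.map_cons, Multiset.prod_cons, Multiset.sum_cons, Multiset.card_cons, ih]
    rw [add_sub_add_comm, Circle.exp_add, pow_succ, blaschke]
    ac_rfl

/-- The total phase of a quotient of Blaschke products, up to a constant. -/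
def blaschkeSum (U L : Multiset ℂ) (z : Circle) : ℝ :=
  (U.map fun c => blaschkePhase c z).sum - (L.map fun c => blaschkePhase c z).sum

lemma prod_div_prod_blaschke (U L : Multiset ℂ) (z : Circle) :
    (U.map fun c => blaschke c z).prod / (L.map fun c => blaschke c z).prod =
      z ^ ((U.card : ℤ) - L.card) * Circle.exp (blaschkeSum U L z - blaschkeSum U L 1) := by
  rw [prod_map_blaschke, prod_map_blaschke, mul_div_mul_comm, ← Circle.exp_sub, zpow_sub,
    zpow_natCast, zpow_natCast, div_eq_mul_inv, blaschkeSum, blaschkeSum]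
  congr 2
  ring

lemma continuous_blaschkeSum {U L : Multiset ℂ} (hU : ∀ c ∈ U, ‖c‖ < 1) (hL : ∀ c ∈ L, ‖c‖ < 1) :
    Continuous (blaschkeSum U L) :=
  (continuous_multiset_sum U fun c hc => continuous_blaschkePhase (hU c hc)).sub
    (continuous_multiset_sum L fun c hc => continuous_blaschkePhase (hL c hc))

lemma poissonFlow_blaschkeSum {t : ℝ} (ht : t ∈ Icc (0 : ℝ) 1) {U L : Multiset ℂ}
    (hU : ∀ c ∈ U, ‖c‖ < 1) (hL : ∀ c ∈ L, ‖c‖ < 1) (z : Circle) :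
    poissonFlow t (blaschkeSum U L) z =
      blaschkeSum (U.map fun c => t * c) (L.map fun c => t * c) z := by
  have hsum {S : Multiset ℂ} (hS : ∀ c ∈ S, ‖c‖ < 1) :
      poissonFlow t (fun w => (S.map fun c => blaschkePhase c w).sum) z =
        ((S.map fun c => (t : ℂ) * c).map fun c => blaschkePhase c z).sum := by
    rw [poissonFlow_multiset_sum S (fun c hc => continuous_blaschkePhase (hS c hc)),
      Multiset.map_map]
    exact congrArg Multiset.sum
      (Multiset.map_congr rfl fun c hc => poissonFlow_blaschkePhase ht (hS c hc) z)
  rw [blaschkeSum, ← hsum hU, ← hsum hL, sub_eq_add_neg, ← poissonFlow_neg]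
  exact poissonFlow_add
    (continuous_multiset_sum U fun c hc => continuous_blaschkePhase (hU c hc))
    (continuous_multiset_sum L fun c hc => continuous_blaschkePhase (hL c hc)).neg t z

/-- `poissonFlow` as a continuous map on the circle. -/
def poissonMap (p : I × C(Circle, ℝ)) : C(Circle, ℝ) where
  toFun := poissonFlow p.1 p.2
  continuous_toFun := continuous_poissonFlow continuous_const (fun _ => p.1.2) continuous_const
    continuous_id

lemma continuous_poissonMap : Continuous poissonMap :=
  ContinuousMap.continuous_of_continuous_uncurry _ <|
    continuous_poissonFlow (t := fun q : (I × C(Circle, ℝ)) × Circle => (q.1.1 : ℝ))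
      (by fun_prop) (fun q => q.1.1.2) (by fun_prop) continuous_snd

lemma continuous_circleMapOfLoop : Continuous circleMapOfLoop :=
  (ContinuousMap.continuous_postcomp _).comp
    ((ContinuousMap.continuous_precomp _).comp continuous_subtype_val)

/-- The deformation of loops that applies `poissonFlow` to the phase. -/
def loopFlow (p : I × OmegaRP 1) : OmegaRP 1 :=
  let φ := poissonMap (p.1, circlePhase (circleMapOfLoop p.2))
  ⟨⟨fun x => homeoRP.symm (homeoOnePoint x ^ circleDeg (circleMapOfLoop p.2) *
    Circle.exp (φ (homeoOnePoint x) - φ 1)), by fun_prop⟩, by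
    refine homeoRP.injective ?_
    simp [homeoOnePoint_apply, cayley_infty, homeoRP_basept]⟩

lemma circleMapOfLoop_loopFlow (t : I) (f : OmegaRP 1) (z : Circle) :
    circleMapOfLoop (loopFlow (t, f)) z = z ^ circleDeg (circleMapOfLoop f) *
      Circle.exp (poissonFlow t (circlePhase (circleMapOfLoop f)) z -
        poissonFlow t (circlePhase (circleMapOfLoop f)) 1) := by
  simp [circleMapOfLoop_apply, loopFlow, poissonMap]

lemma circleMapOfLoop_injective : Function.Injective circleMapOfLoop := by
  intro f g h
  refine Subtype.ext (ContinuousMap.ext fun x => homeoRP.injective ?_)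
  rw [← circleMapOfLoop_cayley, ← circleMapOfLoop_cayley, h]

lemma continuous_loopFlow : Continuous loopFlow := by
  refine Continuous.subtype_mk (ContinuousMap.continuous_of_continuous_uncurry _ ?_) _
  have hpow : Continuous fun q : ℤ × Circle => q.2 ^ q.1 :=
    continuous_prod_of_discrete_left.2 fun d => continuous_zpow d
  have hmap : Continuous fun q : (I × OmegaRP 1) × OnePoint ℝ => circleMapOfLoop q.1.2 :=
    continuous_circleMapOfLoop.comp (by fun_prop)
  have hpois : Continuous fun q : (I × OmegaRP 1) × OnePoint ℝ =>
      poissonMap (q.1.1, circlePhase (circleMapOfLoop q.1.2)) :=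
    continuous_poissonMap.comp
      ((by fun_prop : Continuous fun q : (I × OmegaRP 1) × OnePoint ℝ => q.1.1).prodMk
        (continuous_circlePhase.comp hmap))
  have hx : Continuous fun q : (I × OmegaRP 1) × OnePoint ℝ => homeoOnePoint q.2 := by fun_prop
  exact homeoRP.symm.continuous.comp ((hpow.comp ((continuous_circleDeg.comp hmap).prodMk hx)).mul
    (Circle.exp.continuous.comp ((hpois.eval hx).sub (hpois.eval continuous_const))))

lemma loopFlow_one (f : OmegaRP 1) : loopFlow (1, f) = f := by
  refine circleMapOfLoop_injective (ContinuousMap.ext fun z => ?_)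
  have h := eq_zpow_mul_exp_phase (circleMapOfLoop f) z
  rw [circleMapOfLoop_one, one_mul] at h
  rw [circleMapOfLoop_loopFlow, h]
  simp [poissonFlow_one, circlePhase_one]

lemma loopFlow_zero {f g : OmegaRP 1}
    (h : circleDeg (circleMapOfLoop f) = circleDeg (circleMapOfLoop g)) :
    loopFlow (0, f) = loopFlow (0, g) := by
  refine circleMapOfLoop_injective (ContinuousMap.ext fun z => ?_)
  rw [circleMapOfLoop_loopFlow, circleMapOfLoop_loopFlow, h]
  simp [poissonFlow_zero _ z]

lemma loopFlow_mem_RRat {n : ℕ} {t : I} (ht : 0 < t) {f : OmegaRP 1} (hf : f ∈ RRat n 1) :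
    loopFlow (t, f) ∈ RRat n 1 := by
  obtain ⟨U, L, hU, hL, hdisj, hcard, hf⟩ := mem_RRat_iff_exists_multiset.1 hf
  have ht0 : (0 : ℝ) < t := ht
  have htc : (t : ℂ) ≠ 0 := ofReal_ne_zero.2 ht0.ne'
  have hcont := continuous_blaschkeSum hU hL
  let φ : C(Circle, ℝ) :=
    ⟨fun z => blaschkeSum U L z + -blaschkeSum U L 1, hcont.add continuous_const⟩
  have hφ_apply (z : Circle) : φ z = blaschkeSum U L z - blaschkeSum U L 1 :=
    (sub_eq_add_neg _ _).symm
  obtain ⟨hd, hφ⟩ := circleDeg_circlePhase_eq (g := circleMapOfLoop f) (φ := φ)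
    (d := (U.card : ℤ) - L.card) (by simp [hφ_apply]) fun z => by
      rw [hf, prod_div_prod_blaschke, circleMapOfLoop_one, one_mul, hφ_apply]
  have hlt {S : Multiset ℂ} (hS : ∀ c ∈ S, ‖c‖ < 1) :
      ∀ c ∈ S.map fun c => ((t : ℝ) : ℂ) * c, ‖c‖ < 1 := by
    intro c hc
    obtain ⟨a, ha, rfl⟩ := Multiset.mem_map.1 hc
    rw [norm_mul, norm_real, Real.norm_of_nonneg ht0.le]
    nlinarith [hS a ha, t.2.2, norm_nonneg a]
  refine mem_RRat_iff_exists_multiset.2 ⟨U.map fun c => t * c, L.map fun c => t * c, hlt hU, hlt hL,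
    fun c hc hc' => ?_, by simpa using hcard, fun z => ?_⟩
  · obtain ⟨a, ha, rfl⟩ := Multiset.mem_map.1 hc
    obtain ⟨b, hb, hab⟩ := Multiset.mem_map.1 hc'
    exact hdisj a ha (mul_left_cancel₀ htc hab ▸ hb)
  · have hflow (w : Circle) : poissonFlow t φ w =
        blaschkeSum (U.map fun c => t * c) (L.map fun c => t * c) w + -blaschkeSum U L 1 := by
      refine (poissonFlow_add hcont continuous_const t w).trans ?_
      rw [poissonFlow_const, poissonFlow_blaschkeSum t.2 hU hL]
    rw [prod_div_prod_blaschke, circleMapOfLoop_loopFlow, hd, hφ, hflow, hflow,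
      add_sub_add_right_eq_sub, Multiset.card_map, Multiset.card_map]

/-- For every `n ≥ 1`, every path component of `rat(n,1)` is contractible. -/
theorem ratSet_n1_pathComponents_contractible (n : ℕ) (hn : 1 ≤ n)
    (f : ↥(ratSet n 1)) : ContractibleSpace ↥(pathComponent f) :=
  contractibleSpace_pathComponent_closure
    (continuous_circleDeg.comp continuous_circleMapOfLoop) continuous_loopFlow loopFlow_one
    (fun _ ht _ hf => loopFlow_mem_RRat ht hf) (fun _ _ h => loopFlow_zero h) f

end
end
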